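/- arXiv:2003.05706 — 7 statements merged into one kernel-verified Lean document; each statement's English description precedes it below -/
import Mathlib

section
/- For every total computable function φ : ℕ → ℕ, there exists a Σ⁰₁ set A ⊆ ℕ that is φ-impredictable. -/
open Classical in
/-- Characteristic sequence of a set of naturals. -/
noncomputable def charSeq (A : Set ℕ) : ℕ → Bool := fun i => decide (i ∈ A)

/-- The length-`m` prefix of the characteristic sequence of `A`. -/
noncomputable def charPrefix (A : Set ℕ) (m : ℕ) : List Bool :=
  (List.range m).map (charSeq A)

/-- `A` is Σ⁰₁ (recursively enumerable). -/
def IsSigma01 (A : Set ℕ) : Prop :=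
  ∃ f : ℕ →. ℕ, Partrec f ∧ ∀ n, n ∈ A ↔ (f n).Dom

/-- `A` many-one reduces to `B`. -/
def ManyOneRed (A B : Set ℕ) : Prop :=
  ∃ f : ℕ → ℕ, Computable f ∧ ∀ n, n ∈ A ↔ f n ∈ B

/-- `A` is `φ`-impredictable with witness `ψ`. -/
def ImpredictableWith (φ : ℕ → ℕ) (A : Set ℕ) (ψ : ℕ → ℕ) : Prop :=
  ∀ χ : ℕ × List Bool →. ℕ, Partrec χ →
    ∀ N : ℕ, ∃ p : ℕ, N ≤ p ∧ (ψ p ∈ A ↔ (χ (p, charPrefix A (φ p))).Dom)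

/-- `A` is `φ`-impredictable. -/
def Impredictable (φ : ℕ → ℕ) (A : Set ℕ) : Prop :=
  ∃ ψ : ℕ → ℕ, Computable ψ ∧ ImpredictableWith φ A ψ

/-- Bitwise comparison of binary strings of equal length. -/
def bitLE (u v : List Bool) : Prop := List.Forall₂ (· ≤ ·) u v

/-- `B` wtt-reduces to `A` with rate `β`. -/
def WttRedRate (B A : Set ℕ) (β : ℕ → ℕ) : Prop :=
  Computable β ∧ Monotone β ∧ Filter.Tendsto β Filter.atTop Filter.atTop ∧
  ∃ g : List Bool →. List Bool, Partrec g ∧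
    ∀ m : ℕ, ∃ out : List Bool, out ∈ g (charPrefix A m) ∧
      out = charPrefix B out.length ∧ β m ≤ out.length

/-- `B` conjunctively reduces to `A` with rate `β`. -/
def ConjRedRate (B A : Set ℕ) (β : ℕ → ℕ) : Prop :=
  Computable β ∧ Monotone β ∧ Filter.Tendsto β Filter.atTop Filter.atTop ∧
  ∃ g : List Bool → List Bool, Computable g ∧
    (∀ w : List Bool, (g w).length = β w.length) ∧
    (∀ u v : List Bool, bitLE u v → bitLE (g u) (g v)) ∧
    (∀ m : ℕ, g (charPrefix A m) = charPrefix B (β m)) ∧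
    ∃ w : ℕ → ℕ → List Bool, Computable₂ w ∧ (∀ i m, (w i m).length = m) ∧
      ∀ (u v : List Bool) (i : ℕ), u.length = v.length →
        (bitLE (w i u.length) u ↔ bitLE (w i u.length) v) →
        (g u).getD i false = (g v).getD i false

open Nat.Partrec (Code)

/-- Strictly increasing computable majorant. -/
def psiFn (φ : ℕ → ℕ) (p : ℕ) : ℕ :=
  Nat.rec (φ 0) (fun q r => r + φ (q + 1) + 1) p

theorem psiFn_computable {φ : ℕ → ℕ} (hφ : Computable φ) : Computable (psiFn φ) := by
  unfold psiFn
  refine Computable.nat_rec (f := fun p : ℕ => p) (g := fun _ => φ 0)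
    (h := fun _ (x : ℕ × ℕ) => x.2 + φ (x.1 + 1) + 1) Computable.id (Computable.const _) ?_
  have h1 : Computable fun x : ℕ × (ℕ × ℕ) => φ (x.2.1 + 1) :=
    hφ.comp (Primrec.succ.to_comp.comp (Computable.fst.comp Computable.snd))
  have h2 : Computable fun x : ℕ × (ℕ × ℕ) => x.2.2 := Computable.snd.comp Computable.snd
  exact Primrec.succ.to_comp.comp (Primrec.nat_add.to_comp.comp h2 h1)

theorem psiFn_strictMono (φ : ℕ → ℕ) : StrictMono (psiFn φ) := by
  refine strictMono_nat_of_lt_succ fun n => ?_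
  change psiFn φ n < psiFn φ n + φ (n + 1) + 1
  omega

theorem le_psiFn (φ : ℕ → ℕ) (p : ℕ) : φ p ≤ psiFn φ p := by
  cases p with
  | zero => exact le_rfl
  | succ n =>
    change φ (n + 1) ≤ psiFn φ n + φ (n + 1) + 1
    omega

/-- Bit of a coded finite set. -/
def bitOf (D : List ℕ) (q : ℕ) : Bool := decide (D.getD q 0 = 1)

theorem bitOf_primrec : Primrec₂ bitOf := by
  have h : Primrec₂ fun (D : List ℕ) (q : ℕ) => D.getD q 0 := Primrec.list_getD 0
  have := Primrec.eq (α := ℕ) |>.decide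
  exact this.comp h (Primrec.const 1)

attribute [irreducible] bitOf

/-- Number of elements below `a`. -/
def cnt (D : List ℕ) (a : ℕ) : ℕ :=
  Nat.rec 0 (fun q r => r + (bitOf D q).toNat) a

/-- Halting within `k` steps. -/
def evs (k : ℕ) (c : Code) (x : ℕ) : Bool := (Code.evaln k c x).isSome

theorem evs_computable : Computable fun a : (ℕ × Code) × ℕ => evs a.1.1 a.1.2 a.2 :=
  (Primrec.option_isSome.comp Code.primrec_evaln).to_comp

theorem isSome_evaln_iff (c : Code) (x : ℕ) :
    (c.eval x).Dom ↔ ∃ k, evs k c x = true := by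
  unfold evs
  rw [Part.dom_iff_mem]
  simp only [Code.evaln_complete, Option.isSome_iff_exists, Option.mem_def]
  exact exists_comm

theorem isSome_evaln_mono {c : Code} {x k l : ℕ} (h : k ≤ l)
    (hk : evs k c x = true) : evs l c x = true := by
  unfold evs at *
  rw [Option.isSome_iff_exists] at *
  obtain ⟨y, hy⟩ := hk
  exact ⟨y, Code.evaln_mono h hy⟩

attribute [irreducible] evs

/-- All elements below `a` are in the domain of the code in `k` steps. -/
def allIn (c : Code) (k : ℕ) (D : List ℕ) (a : ℕ) : Bool :=
  Nat.rec true (fun q r => r && (!(bitOf D q) || evs k c q)) a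

/-- `i` is the image of an element below `a`. -/
def img (ψ : ℕ → ℕ) (D : List ℕ) (a i : ℕ) : Bool :=
  Nat.rec false (fun q r => r || (bitOf D q && decide (ψ q = i))) a

/-- Guessed prefix. -/
def guess (ψ : ℕ → ℕ) (D : List ℕ) (a l : ℕ) : List Bool :=
  Nat.rec [] (fun i r => r ++ [img ψ D a i]) l

/-- Power of three. -/
def pow3 (n : ℕ) : ℕ := Nat.rec 1 (fun _ r => 3 * r) n

theorem pow3_primrec : Primrec pow3 := by
  unfold pow3
  exact Primrec.nat_rec (f := fun _ : Unit => 1) (g := fun _ (x : ℕ × ℕ) => 3 * x.2)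
    (Primrec.const 1) (Primrec.nat_mul.comp (Primrec.const 3) (Primrec.snd.comp Primrec.snd))
    |>.comp (Primrec.const ()) Primrec.id

theorem and_c : Computable₂ and := Primrec.and.to_comp
theorem or_c : Computable₂ or := Primrec.or.to_comp
theorem not_c : Computable not := Primrec.not.to_comp

theorem toNat_c : Computable Bool.toNat := (Primrec.dom_finite _).to_comp

theorem cnt_computable : Computable₂ cnt := by
  unfold cnt
  refine Computable.nat_rec (f := fun x : List ℕ × ℕ => x.2) (g := fun _ => 0)
    (h := fun x (y : ℕ × ℕ) => y.2 + (bitOf x.1 y.1).toNat) Computable.snd (Computable.const _) ?_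
  have h1 : Computable fun z : (List ℕ × ℕ) × (ℕ × ℕ) => bitOf z.1.1 z.2.1 :=
    bitOf_primrec.to_comp.comp (Computable.fst.comp Computable.fst)
      (Computable.fst.comp Computable.snd)
  exact Primrec.nat_add.to_comp.comp (Computable.snd.comp Computable.snd) (toNat_c.comp h1)

theorem allIn_computable :
    Computable fun x : (Code × ℕ) × (List ℕ × ℕ) => allIn x.1.1 x.1.2 x.2.1 x.2.2 := by
  have h1 : Computable fun z : ((Code × ℕ) × (List ℕ × ℕ)) × (ℕ × Bool) => bitOf z.1.2.1 z.2.1 :=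
    bitOf_primrec.to_comp.comp (Computable.fst.comp (Computable.snd.comp Computable.fst))
      (Computable.fst.comp Computable.snd)
  have hg : Computable fun z : ((Code × ℕ) × (List ℕ × ℕ)) × (ℕ × Bool) =>
      ((z.1.1.2, z.1.1.1), z.2.1) :=
    Computable.pair (Computable.pair
        (Computable.snd.comp (Computable.fst.comp Computable.fst))
        (Computable.fst.comp (Computable.fst.comp Computable.fst)))
        (Computable.fst.comp Computable.snd)
  have h2 : Computable fun z : ((Code × ℕ) × (List ℕ × ℕ)) × (ℕ × Bool) =>
      evs z.1.1.2 z.1.1.1 z.2.1 :=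
    by have t := evs_computable.comp hg; exact t
  have h3 := and_c.comp (Computable.snd.comp Computable.snd) (or_c.comp (not_c.comp h1) h2)
  have h4 := Computable.nat_rec (f := fun x : (Code × ℕ) × (List ℕ × ℕ) => x.2.2) (g := fun _ => true)
    (h := fun x (y : ℕ × Bool) => y.2 && (!(bitOf x.2.1 y.1) || evs x.1.2 x.1.1 y.1))
    (Computable.snd.comp Computable.snd) (Computable.const _) h3
  exact h4.of_eq fun x => rfl

theorem img_computable {ψ : ℕ → ℕ} (hψ : Computable ψ) :
    Computable fun x : (List ℕ × ℕ) × ℕ => img ψ x.1.1 x.1.2 x.2 := by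
  have h1 : Computable fun z : ((List ℕ × ℕ) × ℕ) × (ℕ × Bool) => bitOf z.1.1.1 z.2.1 :=
    bitOf_primrec.to_comp.comp (Computable.fst.comp (Computable.fst.comp Computable.fst))
      (Computable.fst.comp Computable.snd)
  have he : Primrec₂ fun a b : ℕ => decide (a = b) := Primrec.eq.decide
  have h2 : Computable fun z : ((List ℕ × ℕ) × ℕ) × (ℕ × Bool) => decide (ψ z.2.1 = z.1.2) :=
    he.to_comp.comp (hψ.comp (Computable.fst.comp Computable.snd))
      (Computable.snd.comp Computable.fst)
  have h3 := or_c.comp (Computable.snd.comp Computable.snd) (and_c.comp h1 h2)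
  have h4 := Computable.nat_rec (f := fun x : (List ℕ × ℕ) × ℕ => x.1.2) (g := fun _ => false)
    (h := fun x (y : ℕ × Bool) => y.2 || (bitOf x.1.1 y.1 && decide (ψ y.1 = x.2)))
    (Computable.snd.comp Computable.fst) (Computable.const _) h3
  exact h4.of_eq fun x => rfl

theorem guess_computable {ψ : ℕ → ℕ} (hψ : Computable ψ) :
    Computable fun x : (List ℕ × ℕ) × ℕ => guess ψ x.1.1 x.1.2 x.2 := by
  have hg : Computable fun z : ((List ℕ × ℕ) × ℕ) × (ℕ × List Bool) => (z.1.1, z.2.1) :=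
    Computable.pair (Computable.fst.comp Computable.fst) (Computable.fst.comp Computable.snd)
  have h1 : Computable fun z : ((List ℕ × ℕ) × ℕ) × (ℕ × List Bool) =>
      img ψ z.1.1.1 z.1.1.2 z.2.1 :=
    by have t := (img_computable hψ).comp hg; exact t
  have h3 := Primrec.list_concat.to_comp.comp (Computable.snd.comp Computable.snd) h1
  have h4 := Computable.nat_rec (f := fun x : (List ℕ × ℕ) × ℕ => x.2) (g := fun _ => [])
    (h := fun x (y : ℕ × List Bool) => y.2 ++ [img ψ x.1.1 x.1.2 y.1])
    Computable.snd (Computable.const _) h3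
  exact h4.of_eq fun x => rfl

theorem pow3_eq (n : ℕ) : pow3 n = 3 ^ n := by
  induction n with
  | zero => rfl
  | succ n ih =>
    change 3 * pow3 n = _
    rw [ih]; ring

theorem cnt_eq (D : List ℕ) (a : ℕ) :
    cnt D a = ((Finset.range a).filter fun q => bitOf D q = true).card := by
  induction a with
  | zero => rfl
  | succ a ih =>
    change cnt D a + (bitOf D a).toNat = _
    rw [ih, Finset.range_add_one, Finset.filter_insert]
    cases h : bitOf D a <;> simp

theorem allIn_iff (c : Code) (k : ℕ) (D : List ℕ) (a : ℕ) :
    allIn c k D a = true ↔ ∀ q < a, bitOf D q = true → evs k c q = true := by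
  induction a with
  | zero => simp [allIn]
  | succ a ih =>
    change (allIn c k D a && _) = true ↔ _
    rw [Bool.and_eq_true, ih]
    simp only [Nat.lt_succ_iff_lt_or_eq, or_imp, forall_and, forall_eq]
    cases bitOf D a <;> simp

theorem img_iff (ψ : ℕ → ℕ) (D : List ℕ) (a i : ℕ) :
    img ψ D a i = true ↔ ∃ q < a, bitOf D q = true ∧ ψ q = i := by
  induction a with
  | zero => simp [img]
  | succ a ih =>
    change (img ψ D a i || _) = true ↔ _
    rw [Bool.or_eq_true, ih]
    simp only [Nat.lt_succ_iff_lt_or_eq, or_and_right, exists_or, exists_eq_left]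
    simp

theorem guess_eq (ψ : ℕ → ℕ) (D : List ℕ) (a l : ℕ) :
    guess ψ D a l = (List.range l).map (img ψ D a) := by
  induction l with
  | zero => rfl
  | succ l ih =>
    change guess ψ D a l ++ _ = _
    rw [ih, List.range_succ]; simp

attribute [irreducible] pow3 cnt allIn img guess

/-- The search condition. -/
def check (φ ψ : ℕ → ℕ) (c : Code) (p : ℕ) (D : List ℕ) (n k : ℕ) : Bool :=
  (decide (cnt D (pow3 n) + p = 2 * pow3 n) && allIn c k D (pow3 n)) &&
    evs k (Denumerable.ofNat Code n.unpair.1)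
      (Encodable.encode (p, guess ψ D (pow3 n) (φ p)))

theorem check_computable {φ ψ : ℕ → ℕ} (hφ : Computable φ) (hψ : Computable ψ) :
    Computable fun x : (Code × ℕ) × (List ℕ × ℕ × ℕ) =>
      check φ ψ x.1.1 x.1.2 x.2.1 x.2.2.1 x.2.2.2 := by
  unfold check
  have hc : Computable fun x : (Code × ℕ) × (List ℕ × ℕ × ℕ) => x.1.1 :=
    Computable.fst.comp Computable.fst
  have hp : Computable fun x : (Code × ℕ) × (List ℕ × ℕ × ℕ) => x.1.2 :=
    Computable.snd.comp Computable.fst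
  have hD : Computable fun x : (Code × ℕ) × (List ℕ × ℕ × ℕ) => x.2.1 :=
    Computable.fst.comp Computable.snd
  have hn : Computable fun x : (Code × ℕ) × (List ℕ × ℕ × ℕ) => x.2.2.1 :=
    Computable.fst.comp (Computable.snd.comp Computable.snd)
  have hk : Computable fun x : (Code × ℕ) × (List ℕ × ℕ × ℕ) => x.2.2.2 :=
    Computable.snd.comp (Computable.snd.comp Computable.snd)
  have ha : Computable fun x : (Code × ℕ) × (List ℕ × ℕ × ℕ) => pow3 x.2.2.1 :=
    pow3_primrec.to_comp.comp hn
  have he : Primrec₂ fun a b : ℕ => decide (a = b) := Primrec.eq.decide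
  have h1 : Computable fun x : (Code × ℕ) × (List ℕ × ℕ × ℕ) =>
      decide (cnt x.2.1 (pow3 x.2.2.1) + x.1.2 = 2 * pow3 x.2.2.1) :=
    he.to_comp.comp (Primrec.nat_add.to_comp.comp (cnt_computable.comp hD ha) hp)
      (Primrec.nat_mul.to_comp.comp (Computable.const 2) ha)
  have g2 : Computable fun x : (Code × ℕ) × (List ℕ × ℕ × ℕ) =>
      ((x.1.1, x.2.2.2), (x.2.1, pow3 x.2.2.1)) :=
    Computable.pair (Computable.pair hc hk) (Computable.pair hD ha)
  have h2 : Computable fun x : (Code × ℕ) × (List ℕ × ℕ × ℕ) =>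
      allIn x.1.1 x.2.2.2 x.2.1 (pow3 x.2.2.1) := by
    have t := allIn_computable.comp g2
    exact t
  have g3 : Computable fun x : (Code × ℕ) × (List ℕ × ℕ × ℕ) =>
      ((x.2.1, pow3 x.2.2.1), φ x.1.2) :=
    Computable.pair (Computable.pair hD ha) (hφ.comp hp)
  have h3 : Computable fun x : (Code × ℕ) × (List ℕ × ℕ × ℕ) =>
      guess ψ x.2.1 (pow3 x.2.2.1) (φ x.1.2) := by
    have t := (guess_computable hψ).comp g3
    exact t
  have h4 : Computable fun x : (Code × ℕ) × (List ℕ × ℕ × ℕ) =>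
      Encodable.encode (x.1.2, guess ψ x.2.1 (pow3 x.2.2.1) (φ x.1.2)) :=
    Computable.encode.comp (Computable.pair hp h3)
  have h5 : Computable fun x : (Code × ℕ) × (List ℕ × ℕ × ℕ) =>
      Denumerable.ofNat Code x.2.2.1.unpair.1 :=
    (Computable.ofNat Code).comp (Computable.fst.comp (Computable.unpair.comp hn))
  have g6 : Computable fun x : (Code × ℕ) × (List ℕ × ℕ × ℕ) =>
      ((x.2.2.2, Denumerable.ofNat Code x.2.2.1.unpair.1),
        Encodable.encode (x.1.2, guess ψ x.2.1 (pow3 x.2.2.1) (φ x.1.2))) :=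
    Computable.pair (Computable.pair hk h5) h4
  have h6 := evs_computable.comp g6
  exact and_c.comp (and_c.comp h1 h2) h6

theorem exists_code_eq {φ ψ : ℕ → ℕ} (hφ : Computable φ) (hψ : Computable ψ) :
    ∃ c : Code, ∀ p, (c.eval p).Dom ↔ ∃ D n k, check φ ψ c p D n k = true := by
  let F : Code → ℕ →. ℕ := fun c p => Nat.rfind fun m =>
    Part.some (check φ ψ c p (Denumerable.ofNat (List ℕ × ℕ × ℕ) m).1
      (Denumerable.ofNat (List ℕ × ℕ × ℕ) m).2.1 (Denumerable.ofNat (List ℕ × ℕ × ℕ) m).2.2)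
  have hF : Partrec₂ F := by
    refine Partrec.rfind (p := fun (x : Code × ℕ) m =>
      Part.some (check φ ψ x.1 x.2 (Denumerable.ofNat (List ℕ × ℕ × ℕ) m).1
      (Denumerable.ofNat (List ℕ × ℕ × ℕ) m).2.1 (Denumerable.ofNat (List ℕ × ℕ × ℕ) m).2.2)) ?_
    have := (check_computable hφ hψ).comp (Computable.pair (Computable.fst (α := Code × ℕ) (β := ℕ))
      ((Computable.ofNat (List ℕ × ℕ × ℕ)).comp Computable.snd))
    exact this.partrec
  obtain ⟨c, hc⟩ := Code.fixed_point₂ hF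
  refine ⟨c, fun p => ?_⟩
  rw [hc]
  constructor
  · intro h
    have := Nat.rfind_spec (Part.get_mem h)
    exact ⟨_, _, _, (Part.mem_some_iff.1 this).symm⟩
  · rintro ⟨D, n, k, h⟩
    refine (Nat.rfind_dom').2 ⟨Encodable.encode (D, n, k), ?_, fun _ => trivial⟩
    simp [h]

theorem exists_bound (c : Code) (a : ℕ) :
    ∃ k, ∀ q < a, (c.eval q).Dom → evs k c q = true := by
  induction a with
  | zero => exact ⟨0, by simp⟩
  | succ a ih =>
    obtain ⟨k, hk⟩ := ih
    by_cases h : (c.eval a).Dom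
    · obtain ⟨l, hl⟩ := (isSome_evaln_iff c a).1 h
      refine ⟨max k l, fun q hq hd => ?_⟩
      rcases Nat.lt_succ_iff_lt_or_eq.1 hq with hq | rfl
      · exact isSome_evaln_mono (le_max_left _ _) (hk q hq hd)
      · exact isSome_evaln_mono (le_max_right _ _) hl
    · refine ⟨k, fun q hq hd => ?_⟩
      rcases Nat.lt_succ_iff_lt_or_eq.1 hq with hq | rfl
      · exact hk q hq hd
      · exact absurd hd h

theorem exists_code_chi {χ : ℕ × List Bool →. ℕ} (h : Partrec χ) :
    ∃ e : Code, ∀ x, (e.eval (Encodable.encode x)).Dom ↔ (χ x).Dom := by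
  obtain ⟨e, he⟩ := Code.exists_code.1 h
  refine ⟨e, fun x => ?_⟩
  rw [he]
  simp

open Classical in
theorem main_point {φ ψ : ℕ → ℕ} (hmono : StrictMono ψ) (hle : ∀ p, φ p ≤ ψ p) {c : Code}
    (hc : ∀ p, (c.eval p).Dom ↔ ∃ D n k, check φ ψ c p D n k = true) (e : Code) (N : ℕ) :
    ∃ p, N ≤ p ∧ ((c.eval p).Dom ↔ (e.eval (Encodable.encode
      (p, charPrefix {x | ∃ q, ψ q = x ∧ (c.eval q).Dom} (φ p)))).Dom) := by
  set n := Nat.pair (Encodable.encode e) N with hn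
  have hNn : N ≤ n := Nat.right_le_pair _ _
  set a := 3 ^ n with ha
  have hna : n < a := Nat.lt_pow_self (by norm_num)
  set S := (Finset.range a).filter fun q => (c.eval q).Dom with hS
  have hSa : S.card ≤ a := by
    simpa using Finset.card_filter_le (Finset.range a) fun q => (c.eval q).Dom
  -- facts drawn from a successful check on this block
  have key : ∀ p D m k, a ≤ p → p ≤ 2 * a → check φ ψ c p D m k = true →
      m = n ∧ ((Finset.range a).filter fun q => bitOf D q = true) ⊆ S ∧
      ((Finset.range a).filter fun q => bitOf D q = true).card + p = 2 * a ∧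
      (e.eval (Encodable.encode (p, (List.range (φ p)).map (img ψ D a)))).Dom := by
    intro p D m k hp1 hp2 h
    simp only [check, Bool.and_eq_true, decide_eq_true_eq, pow3_eq, cnt_eq, allIn_iff,
      guess_eq] at h
    obtain ⟨⟨h1, h2⟩, h3⟩ := h
    have hle' : ((Finset.range (3 ^ m)).filter fun q => bitOf D q = true).card ≤ 3 ^ m := by
      simpa using Finset.card_filter_le (Finset.range (3 ^ m)) fun q => bitOf D q = true
    have hmn : m = n := by
      rcases lt_trichotomy m n with hlt | heq | hgt
      · have : 3 ^ (m + 1) ≤ a := Nat.pow_le_pow_right (by norm_num) hlt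
        have hpos : 0 < 3 ^ m := by positivity
        rw [pow_succ] at this
        omega
      · exact heq
      · have : 3 ^ (n + 1) ≤ 3 ^ m := Nat.pow_le_pow_right (by norm_num) hgt
        have hpos : 0 < 3 ^ n := by positivity
        rw [pow_succ] at this
        omega
    subst hmn
    refine ⟨rfl, ?_, h1, ?_⟩
    · intro q hq
      rw [Finset.mem_filter, Finset.mem_range] at hq
      rw [hS, Finset.mem_filter, Finset.mem_range]
      exact ⟨hq.1, (isSome_evaln_iff _ _).2 ⟨k, h2 q hq.1 hq.2⟩⟩
    · rw [hn, Nat.unpair_pair, Denumerable.ofNat_encode, ← hn] at h3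
      exact (isSome_evaln_iff _ _).2 ⟨k, h3⟩
  set p := 2 * a - S.card with hp
  have hnone : ∀ q, a ≤ q → q < p → ¬ (c.eval q).Dom := by
    intro q h1 h2 hd
    obtain ⟨D, m, k, h⟩ := (hc q).1 hd
    obtain ⟨-, hs, hcard, -⟩ := key q D m k h1 (by omega) h
    have := Finset.card_le_card hs
    omega
  have hpre : ∀ D, ((Finset.range a).filter fun q => bitOf D q = true) = S →
      (List.range (φ p)).map (img ψ D a) =
        charPrefix {x | ∃ q, ψ q = x ∧ (c.eval q).Dom} (φ p) := by
    intro D hD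
    unfold charPrefix
    refine List.map_congr_left fun i hi => ?_
    rw [List.mem_range] at hi
    rw [Bool.eq_iff_iff, img_iff]
    simp only [charSeq, decide_eq_true_eq, Set.mem_ofPred_eq]
    constructor
    · rintro ⟨q, hq, hb, rfl⟩
      have : q ∈ S := by
        rw [← hD, Finset.mem_filter, Finset.mem_range]; exact ⟨hq, hb⟩
      exact ⟨q, rfl, (Finset.mem_filter.1 this).2⟩
    · rintro ⟨q, rfl, hd⟩
      have hqp : q < p := hmono.lt_iff_lt.1 (lt_of_lt_of_le hi (hle p))
      have hqa : q < a := by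
        by_contra hcon
        exact hnone q (by omega) hqp hd
      have : q ∈ S := Finset.mem_filter.2 ⟨Finset.mem_range.2 hqa, hd⟩
      rw [← hD, Finset.mem_filter] at this
      exact ⟨q, hqa, this.2, rfl⟩
  refine ⟨p, by omega, ?_⟩
  constructor
  · intro hd
    obtain ⟨D, m, k, h⟩ := (hc p).1 hd
    obtain ⟨-, hs, hcard, he⟩ := key p D m k (by omega) (by omega) h
    rw [hpre D (Finset.eq_of_subset_of_card_le hs (by omega))] at he
    exact he
  · intro hd
    let D : List ℕ := (List.range a).map fun q => if (c.eval q).Dom then 1 else 0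
    have hbit : ∀ q < a, (bitOf D q = true ↔ (c.eval q).Dom) := by
      intro q hq
      unfold bitOf
      simp [D, List.getD, hq]
    have hD : ((Finset.range a).filter fun q => bitOf D q = true) = S :=
      Finset.filter_congr fun q hq => hbit q (Finset.mem_range.1 hq)
    rw [← hpre D hD] at hd
    obtain ⟨k, hk⟩ := exists_bound c a
    obtain ⟨l, hl⟩ := (isSome_evaln_iff _ _).1 hd
    refine (hc p).2 ⟨D, n, max k l, ?_⟩
    simp only [check, Bool.and_eq_true, decide_eq_true_eq, pow3_eq, cnt_eq, allIn_iff,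
      guess_eq]
    refine ⟨⟨?_, ?_⟩, ?_⟩
    · rw [← ha, hD]; omega
    · intro q hq hb
      exact isSome_evaln_mono (le_max_left _ _) (hk q hq ((hbit q hq).1 hb))
    · rw [hn, Nat.unpair_pair, Denumerable.ofNat_encode, ← hn]
      exact isSome_evaln_mono (le_max_right _ _) hl

/-- For every total computable `φ` there exists a `φ`-impredictable
Σ⁰₁ set. -/
theorem exists_impredictable_sigma01 (φ : ℕ → ℕ) (hφ : Computable φ) :
    ∃ A : Set ℕ, IsSigma01 A ∧ Impredictable φ A := by
  have hψ := psiFn_computable hφ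
  have hmono := psiFn_strictMono φ
  obtain ⟨c, hc⟩ := exists_code_eq hφ hψ
  refine ⟨{x | ∃ q, psiFn φ q = x ∧ (c.eval q).Dom}, ?_, psiFn φ, hψ, ?_⟩
  · refine ⟨fun x => (Nat.rfind fun q => Part.some (decide (psiFn φ q = x))).bind c.eval, ?_, ?_⟩
    · refine Partrec.bind (Partrec.rfind (p := fun x q => Part.some (decide (psiFn φ q = x))) ?_) ?_
      · have he : Primrec₂ fun a b : ℕ => decide (a = b) := Primrec.eq.decide
        have : Computable fun z : ℕ × ℕ => decide (psiFn φ z.2 = z.1) :=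
          he.to_comp.comp (hψ.comp Computable.snd) Computable.fst
        exact this.partrec
      · have : Partrec c.eval := Partrec.nat_iff.2 (Code.exists_code.2 ⟨c, rfl⟩)
        exact this.comp Computable.snd
    · intro x
      constructor
      · rintro ⟨q, rfl, hd⟩
        have hm : q ∈ Nat.rfind fun r => Part.some (decide (psiFn φ r = psiFn φ q)) := by
          refine Nat.mem_rfind.2 ⟨by simp, fun {m} hm => ?_⟩
          simp [(hmono hm).ne]
        rw [Part.dom_iff_mem] at hd ⊢
        obtain ⟨y, hy⟩ := hd
        exact ⟨y, Part.mem_bind hm hy⟩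
      · intro h
        rw [Part.dom_iff_mem] at h
        obtain ⟨y, hy⟩ := h
        obtain ⟨q, hq, hy⟩ := Part.mem_bind_iff.1 hy
        have := Nat.rfind_spec hq
        refine ⟨q, ?_, Part.dom_iff_mem.2 ⟨y, hy⟩⟩
        simpa using this
  · intro χ hχ N
    obtain ⟨e, he⟩ := exists_code_chi hχ
    obtain ⟨p, hp, h⟩ := main_point hmono (le_psiFn φ) hc e N
    refine ⟨p, hp, ?_⟩
    rw [← he, ← h]
    constructor
    · rintro ⟨q, hq, hd⟩
      rwa [← hmono.injective hq]
    · exact fun hd => ⟨p, rfl, hd⟩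
end

section
/- Let A, B ⊆ ℕ and let φ : ℕ → ℕ be total computable. Suppose A many-one reduces to B, and B wtt-reduces to A with rate β. If A is φ-impredictable, then B is (β ∘ φ)-impredictable. -/
/-- If `A` many-one reduces to `B`, `B` wtt-reduces to `A` with rate `β`,
and `A` is `φ`-impredictable, then `B` is `(β ∘ φ)`-impredictable. -/
theorem impredictable_transfer (A B : Set ℕ) (φ : ℕ → ℕ) (hφ : Computable φ)
    (β : ℕ → ℕ) (hm : ManyOneRed A B) (hwtt : WttRedRate B A β)
    (h : Impredictable φ A) :
    Impredictable (β ∘ φ) B := by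
  obtain ⟨f, hf, hfB⟩ := hm
  obtain ⟨hβ, -, -, g, hg, hgB⟩ := hwtt
  obtain ⟨ψ, hψ, hA⟩ := h
  refine ⟨fun p => f (ψ p), hf.comp hψ, ?_⟩
  intro χ hχ N
  have hχ' : Partrec (fun q : ℕ × List Bool =>
      (g q.2).bind fun out => χ (q.1, out.take (β (φ q.1)))) := by
    refine Partrec.bind (hg.comp Computable.snd) ?_
    have hfst : Computable (fun r : (ℕ × List Bool) × List Bool => r.1.1) :=
      Computable.fst.comp Computable.fst
    have htake : Computable (fun r : (ℕ × List Bool) × List Bool =>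
        r.2.take (β (φ r.1.1))) :=
      (Primrec.list_take.to_comp).comp (hβ.comp (hφ.comp hfst)) Computable.snd
    exact hχ.comp (hfst.pair htake)
  obtain ⟨p, hp, hiff⟩ := hA _ hχ' N
  refine ⟨p, hp, ?_⟩
  rw [← hfB, hiff]
  obtain ⟨out, hout, hpre, hlen⟩ := hgB (φ p)
  have htk : out.take (β (φ p)) = charPrefix B ((β ∘ φ) p) := by
    rw [hpre]
    simp only [charPrefix, Function.comp, ← List.map_take, List.take_range]
    rw [min_eq_left hlen]
  have hb : ((g (charPrefix A (φ p))).bind fun out => χ (p, out.take (β (φ p))))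
      = χ (p, charPrefix B ((β ∘ φ) p)) := by
    rw [Part.eq_some_iff.2 hout, Part.bind_some, htk]
  exact iff_of_eq (congrArg Part.Dom hb)
end

section
/- If A ⊆ ℕ is Π⁰₁ (i.e., the complement of A is Σ⁰₁), then for every total computable function φ : ℕ → ℕ, A is not φ-impredictable. -/
/-- A Π⁰₁ set is not `φ`-impredictable for any total computable `φ`. -/
theorem pi01_not_impredictable (A : Set ℕ) (hA : IsSigma01 Aᶜ)
    (φ : ℕ → ℕ) (hφ : Computable φ) :
    ¬ Impredictable φ A := by
  rintro ⟨ψ, hψ, h⟩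
  obtain ⟨f, hf, hfA⟩ := hA
  obtain ⟨p, -, hp⟩ := h (fun x => f (ψ x.1)) (hf.comp (hψ.comp Computable.fst)) 0
  have h2 : ψ p ∉ A ↔ (f (ψ p)).Dom := hfA (ψ p)
  exact iff_not_self (hp.trans h2.symm)
end

section
/- Let G and H be groups with finite generating sets and let A' ⊆ A ⊆ ℕ. Then X_A ⊆ X_{A'}, every element of K(G,A',H) maps the subset X_A × H of X_{A'} × H to itself, and restriction to X_A × H defines a surjective group homomorphism K(G,A',H) → K(G,A,H) sending each generator ĝ (formed with respect to A') to the corresponding generator ĝ (with respect to A), and each h_b to the corresponding h_b. In particular, K(G,A,H) is a quotient group of K(G,A',H). -/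
/-- Evaluation of a word over the generators (`true` = generator, `false` = inverse). -/
def evalWord {K : Type*} [Group K] {m : ℕ} (gen : Fin m → K) (w : List (Fin m × Bool)) : K :=
  (w.map fun l => if l.2 then gen l.1 else (gen l.1)⁻¹).prod

/-- Index of a word in the length-then-lexicographic enumeration of all words
(bijective base-`2m` numeration). -/
def wordCode {m : ℕ} (w : List (Fin m × Bool)) : ℕ :=
  w.foldl (fun acc l => acc * (2 * m) + (2 * l.1.val + (if l.2 then 1 else 0) + 1)) 0

/-- The word problem of a group with distinguished generators. -/
def WordProblem {K : Type*} [Group K] {m : ℕ} (gen : Fin m → K) : Set ℕ :=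
  { n | ∃ w : List (Fin m × Bool), wordCode w = n ∧ evalWord gen w = 1 }

/-- Word norm with respect to the distinguished generators. -/
noncomputable def wordNorm {K : Type*} [Group K] {m : ℕ} (gen : Fin m → K) (g : K) : ℕ :=
  sInf { ℓ | ∃ w : List (Fin m × Bool), w.length = ℓ ∧ evalWord gen w = g }

/-- The torsion function of a group with distinguished generators. -/
noncomputable def torsionFn {K : Type*} [Group K] {m : ℕ} (gen : Fin m → K) (n : ℕ) : ℕ :=
  sSup { k | ∃ g : K, wordNorm gen g ≤ n ∧ orderOf g = k }

/-- Word metric on a group with distinguished generators. -/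
noncomputable def wordDist {G : Type*} [Group G] {m : ℕ} (gen : Fin m → G) (a b : G) : ℕ :=
  wordNorm gen (a⁻¹ * b)

/-- The subshift `X_A`: configurations with at most two `1`s, whose distance is not in `A`. -/
def XA {G : Type*} [Group G] {m : ℕ} (gen : Fin m → G) (A : Set ℕ) : Set (G → Bool) :=
  { x | (∀ a b c : G, x a = true → x b = true → x c = true → a = b ∨ a = c ∨ b = c) ∧
        (∀ a b : G, x a = true → x b = true → a ≠ b → wordDist gen a b ∉ A) }

/-- Shift action on configurations. -/
def shiftC {G : Type*} [Group G] {α : Type*} (g : G) (x : G → α) : G → α :=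
  fun k => x (g⁻¹ * k)

theorem shiftC_mem_XA {G : Type*} [Group G] {m : ℕ} (gen : Fin m → G) (A : Set ℕ)
    (g : G) {x : G → Bool} (hx : x ∈ XA gen A) : shiftC g x ∈ XA gen A := by
  obtain ⟨h1, h2⟩ := hx
  constructor
  · intro a b c ha hb hc
    rcases h1 _ _ _ ha hb hc with h | h | h
    · exact Or.inl (mul_left_cancel h)
    · exact Or.inr (Or.inl (mul_left_cancel h))
    · exact Or.inr (Or.inr (mul_left_cancel h))
  · intro a b ha hb hab
    have hab' : g⁻¹ * a ≠ g⁻¹ * b := fun h => hab (mul_left_cancel h)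
    have hd := h2 _ _ ha hb hab'
    have he : wordDist gen (g⁻¹ * a) (g⁻¹ * b) = wordDist gen a b := by
      unfold wordDist
      congr 1
      group
    rwa [he] at hd

/-- The generator `ĝ` of `K(G,A,H)`: shift in the first component. -/
def ghat {G : Type*} [Group G] {m : ℕ} (gen : Fin m → G) (A : Set ℕ)
    (H : Type*) (g : G) : Equiv.Perm (↥(XA gen A) × H) where
  toFun p := (⟨shiftC g p.1.1, shiftC_mem_XA gen A g p.1.2⟩, p.2)
  invFun p := (⟨shiftC g⁻¹ p.1.1, shiftC_mem_XA gen A g⁻¹ p.1.2⟩, p.2)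
  left_inv := by
    rintro ⟨⟨x, hx⟩, h'⟩
    simp only [Prod.mk.injEq, Subtype.mk.injEq]
    refine ⟨?_, trivial⟩
    funext k
    show x (g⁻¹ * ((g⁻¹)⁻¹ * k)) = x k
    congr 1
    group
  right_inv := by
    rintro ⟨⟨x, hx⟩, h'⟩
    simp only [Prod.mk.injEq, Subtype.mk.injEq]
    refine ⟨?_, trivial⟩
    funext k
    show x ((g⁻¹)⁻¹ * (g⁻¹ * k)) = x k
    congr 1
    group

/-- The generator `h_b` of `K(G,A,H)`: multiply the `H`-component by `h`
if the configuration reads `b` at the identity. -/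
def hbGen {G : Type*} [Group G] {m : ℕ} (gen : Fin m → G) (A : Set ℕ)
    {H : Type*} [Group H] (h : H) (b : Bool) : Equiv.Perm (↥(XA gen A) × H) where
  toFun p := (p.1, if p.1.1 1 = b then h * p.2 else p.2)
  invFun p := (p.1, if p.1.1 1 = b then h⁻¹ * p.2 else p.2)
  left_inv := by
    rintro ⟨x, h'⟩
    by_cases hc : x.1 1 = b <;> simp [hc]
  right_inv := by
    rintro ⟨x, h'⟩
    by_cases hc : x.1 1 = b <;> simp [hc]

/-- The group `K(G,A,H)` as a subgroup of the permutations of `X_A × H`. -/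
def Ksub {G : Type*} [Group G] {m : ℕ} (gen : Fin m → G) (A : Set ℕ)
    (H : Type*) [Group H] : Subgroup (Equiv.Perm (↥(XA gen A) × H)) :=
  Subgroup.closure
    ((Set.range fun g : G => ghat gen A H g) ∪
     (Set.range fun p : H × Bool => hbGen gen A p.1 p.2))

theorem ghat_mem {G : Type*} [Group G] {m : ℕ} (gen : Fin m → G) (A : Set ℕ)
    (H : Type*) [Group H] (g : G) : ghat gen A H g ∈ Ksub gen A H :=
  Subgroup.subset_closure (Or.inl ⟨g, rfl⟩)

theorem hb_mem {G : Type*} [Group G] {m : ℕ} (gen : Fin m → G) (A : Set ℕ)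
    {H : Type*} [Group H] (h : H) (b : Bool) : hbGen gen A h b ∈ Ksub gen A H :=
  Subgroup.subset_closure (Or.inr ⟨(h, b), rfl⟩)

/-- Inclusion `X_A × H → X_{A'} × H`. -/
def inclXA {G : Type*} [Group G] {m : ℕ} (gen : Fin m → G) (A A' : Set ℕ) (H : Type*)
    (hsub : XA gen A ⊆ XA gen A') (p : ↥(XA gen A) × H) : ↥(XA gen A') × H :=
  (⟨p.1.1, hsub p.1.2⟩, p.2)

theorem inclXA_injective {G : Type*} [Group G] {m : ℕ} (gen : Fin m → G) (A A' : Set ℕ)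
    (H : Type*) (hsub : XA gen A ⊆ XA gen A') :
    Function.Injective (inclXA gen A A' H hsub) := by
  rintro ⟨⟨x, hx⟩, h⟩ ⟨⟨y, hy⟩, k⟩ e
  simpa [inclXA] using e

theorem XA_anti {G : Type*} [Group G] {m : ℕ} (gen : Fin m → G) (A A' : Set ℕ)
    (hAA : A' ⊆ A) : XA gen A ⊆ XA gen A' :=
  fun _ hx => ⟨hx.1, fun a b ha hb hab hm => hx.2 a b ha hb hab (hAA hm)⟩

theorem exists_restr {G H : Type*} [Group G] [Group H] {m : ℕ} (gen : Fin m → G)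
    (A A' : Set ℕ) (hsub : XA gen A ⊆ XA gen A')
    (σ : Equiv.Perm (↥(XA gen A') × H)) (hσ : σ ∈ Ksub gen A' H) :
    ∃ τ ∈ Ksub gen A H, ∀ p, σ (inclXA gen A A' H hsub p) = inclXA gen A A' H hsub (τ p) := by
  unfold Ksub at hσ
  induction hσ using Subgroup.closure_induction with
  | mem x hx =>
    rcases hx with ⟨g, rfl⟩ | ⟨⟨h, b⟩, rfl⟩
    · exact ⟨_, ghat_mem gen A H g, fun p => rfl⟩
    · exact ⟨_, hb_mem gen A h b, fun p => rfl⟩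
  | one => exact ⟨1, one_mem _, fun p => rfl⟩
  | mul x y _ _ hx hy =>
    obtain ⟨s, hs, hs'⟩ := hx
    obtain ⟨t, ht, ht'⟩ := hy
    exact ⟨s * t, mul_mem hs ht, fun p => by simp [Equiv.Perm.mul_apply, hs', ht']⟩
  | inv x _ hx =>
    obtain ⟨s, hs, hs'⟩ := hx
    refine ⟨s⁻¹, inv_mem hs, fun p => ?_⟩
    rw [Equiv.Perm.inv_eq_iff_eq, hs']
    simp

theorem exists_ext {G H : Type*} [Group G] [Group H] {m : ℕ} (gen : Fin m → G)
    (A A' : Set ℕ) (hsub : XA gen A ⊆ XA gen A')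
    (τ : Equiv.Perm (↥(XA gen A) × H)) (hτ : τ ∈ Ksub gen A H) :
    ∃ σ ∈ Ksub gen A' H, ∀ p, σ (inclXA gen A A' H hsub p) = inclXA gen A A' H hsub (τ p) := by
  unfold Ksub at hτ
  induction hτ using Subgroup.closure_induction with
  | mem x hx =>
    rcases hx with ⟨g, rfl⟩ | ⟨⟨h, b⟩, rfl⟩
    · exact ⟨_, ghat_mem gen A' H g, fun p => rfl⟩
    · exact ⟨_, hb_mem gen A' h b, fun p => rfl⟩
  | one => exact ⟨1, one_mem _, fun p => rfl⟩
  | mul x y _ _ hx hy =>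
    obtain ⟨s, hs, hs'⟩ := hx
    obtain ⟨t, ht, ht'⟩ := hy
    exact ⟨s * t, mul_mem hs ht, fun p => by simp [Equiv.Perm.mul_apply, hs', ht']⟩
  | inv x _ hx =>
    obtain ⟨s, hs, hs'⟩ := hx
    refine ⟨s⁻¹, inv_mem hs, fun p => ?_⟩
    rw [Equiv.Perm.inv_eq_iff_eq, hs']
    simp

/-- If `A' ⊆ A` then `X_A ⊆ X_{A'}`, every element of `K(G,A',H)`
maps `X_A × H` to itself, and restriction to `X_A × H` gives a surjective homomorphism
`K(G,A',H) → K(G,A,H)` sending generators to the corresponding generators; in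
particular `K(G,A,H)` is a quotient of `K(G,A',H)`. -/
theorem Ksub_quotient {G H : Type*} [Group G] [Group H] {mG nH : ℕ}
    (genG : Fin mG → G) (genH : Fin nH → H)
    (hG : Subgroup.closure (Set.range genG) = ⊤)
    (hH : Subgroup.closure (Set.range genH) = ⊤)
    (A A' : Set ℕ) (hAA : A' ⊆ A) :
    XA genG A ⊆ XA genG A' ∧
    (∀ σ ∈ Ksub genG A' H, ∀ (x : G → Bool) (hx' : x ∈ XA genG A') (h' : H),
        x ∈ XA genG A → (↑((σ (⟨x, hx'⟩, h')).1) : G → Bool) ∈ XA genG A) ∧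
    ∃ Φ : ↥(Ksub genG A' H) →* ↥(Ksub genG A H),
      Function.Surjective Φ ∧
      (∀ g : G,
        ((Φ ⟨ghat genG A' H g, ghat_mem genG A' H g⟩ : ↥(Ksub genG A H)) :
            Equiv.Perm (↥(XA genG A) × H)) = ghat genG A H g) ∧
      (∀ (h : H) (b : Bool),
        ((Φ ⟨hbGen genG A' h b, hb_mem genG A' h b⟩ : ↥(Ksub genG A H)) :
            Equiv.Perm (↥(XA genG A) × H)) = hbGen genG A h b) ∧
      (∀ (σ : ↥(Ksub genG A' H)) (x : G → Bool) (hxA : x ∈ XA genG A)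
          (hxA' : x ∈ XA genG A') (h' : H),
        (↑((((Φ σ : ↥(Ksub genG A H)) : Equiv.Perm (↥(XA genG A) × H))
              (⟨x, hxA⟩, h')).1) : G → Bool) =
            ↑(((σ : Equiv.Perm (↥(XA genG A') × H)) (⟨x, hxA'⟩, h')).1) ∧
        (((Φ σ : ↥(Ksub genG A H)) : Equiv.Perm (↥(XA genG A) × H)) (⟨x, hxA⟩, h')).2 =
            ((σ : Equiv.Perm (↥(XA genG A') × H)) (⟨x, hxA'⟩, h')).2) := by
  have hsub := XA_anti genG A A' hAA
  have hinj := inclXA_injective genG A A' H hsub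
  refine ⟨hsub, ?_, ?_⟩
  · intro σ hσ x hx' h' hx
    obtain ⟨τ, _, hτ⟩ := exists_restr genG A A' hsub σ hσ
    have e := hτ (⟨x, hx⟩, h')
    change σ (⟨x, hx'⟩, h') = _ at e
    rw [e]
    exact (τ (⟨x, hx⟩, h')).1.2
  · choose f hf hfe using exists_restr (H := H) genG A A' hsub
    have huniq : ∀ σ hσ (τ : Equiv.Perm (↥(XA genG A) × H)),
        (∀ p, σ (inclXA genG A A' H hsub p) = inclXA genG A A' H hsub (τ p)) →
        f σ hσ = τ := by
      intro σ hσ τ h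
      ext1 p
      exact hinj ((hfe σ hσ p).symm.trans (h p))
    refine ⟨MonoidHom.mk' (fun σ => ⟨f σ.1 σ.2, hf σ.1 σ.2⟩) ?_, ?_, ?_, ?_, ?_⟩
    · intro a b
      apply Subtype.ext
      apply huniq
      intro p
      change a.1 (b.1 _) = inclXA genG A A' H hsub (f a.1 a.2 (f b.1 b.2 p))
      rw [hfe b.1 b.2, hfe a.1 a.2]
    · rintro ⟨τ, hτ⟩
      obtain ⟨σ, hσ, h⟩ := exists_ext genG A A' hsub τ hτ
      exact ⟨⟨σ, hσ⟩, Subtype.ext (huniq σ hσ τ h)⟩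
    · intro g
      exact huniq _ _ _ fun p => rfl
    · intro h b
      exact huniq _ _ _ fun p => rfl
    · intro σ x hxA hxA' h'
      have e := hfe σ.1 σ.2 (⟨x, hxA⟩, h')
      change σ.1 (⟨x, hxA'⟩, h') = _ at e
      rw [e]
      exact ⟨rfl, rfl⟩
end

section
/- For any groups G and H with finite generating sets and any A ⊆ ℕ, there is a surjective group homomorphism γ : K(G,A,H) → G with γ(ĝ) = g for every g ∈ G and γ(h_b) = e_G for every h ∈ H and b ∈ {0,1}; moreover the map g ↦ ĝ is a group homomorphism G → K(G,A,H) which is a section of γ. In particular γ is a split epimorphism. -/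
theorem shiftC_mul {G : Type*} [Group G] {α : Type*} (g k : G) (x : G → α) :
    shiftC g (shiftC k x) = shiftC (g * k) x := by
  funext t
  simp [shiftC, mul_assoc]

theorem shiftC_one {G : Type*} [Group G] {α : Type*} (x : G → α) :
    shiftC (1 : G) x = x := by
  funext t
  simp [shiftC]

/-- Every element of `K(G,A,H)` acts on the first component as some shift. -/
theorem Ksub_exists_shift {G H : Type*} [Group G] [Group H] {m : ℕ}
    (gen : Fin m → G) (A : Set ℕ) (f : Equiv.Perm (↥(XA gen A) × H))
    (hf : f ∈ Ksub gen A H) : ∃ g : G, ∀ p, (f p).1.1 = shiftC g p.1.1 := by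
  unfold Ksub at hf
  induction hf using Subgroup.closure_induction with
  | mem x hx =>
    rcases hx with ⟨g, rfl⟩ | ⟨q, rfl⟩
    · exact ⟨g, fun p => rfl⟩
    · exact ⟨1, fun p => (shiftC_one _).symm⟩
  | one => exact ⟨1, fun p => (shiftC_one _).symm⟩
  | mul x y _ _ hx hy =>
    obtain ⟨a, ha⟩ := hx
    obtain ⟨b, hb⟩ := hy
    refine ⟨a * b, fun p => ?_⟩
    rw [Equiv.Perm.mul_apply, ha, hb, shiftC_mul]
  | inv x _ hx =>
    obtain ⟨a, ha⟩ := hx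
    refine ⟨a⁻¹, fun p => ?_⟩
    have h := ha (x⁻¹ p)
    rw [show x (x⁻¹ p) = p from x.apply_symm_apply p] at h
    rw [h, shiftC_mul, inv_mul_cancel, shiftC_one]

/-- The shift is determined by its action, since `X_A` contains a one-point configuration. -/
theorem shift_unique {G : Type*} [Group G] {m : ℕ}
    (gen : Fin m → G) (A : Set ℕ) (a b : G)
    (h : ∀ x ∈ XA gen A, shiftC a x = shiftC b x) : a = b := by
  classical
  have hm : (fun k : G => decide (k = 1)) ∈ XA gen A := by
    constructor
    · intro a b c ha hb _
      simp only [decide_eq_true_eq] at ha hb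
      exact Or.inl (ha.trans hb.symm)
    · intro a b ha hb hab
      simp only [decide_eq_true_eq] at ha hb
      exact absurd (ha.trans hb.symm) hab
  have h1 := congrFun (h _ hm) b
  simp only [shiftC, inv_mul_cancel, decide_true, decide_eq_true_eq] at h1
  exact inv_mul_eq_one.mp h1

/-- The natural split epimorphism `γ : K(G,A,H) → G` with
`γ(ĝ) = g`, `γ(h_b) = e_G`, and section `g ↦ ĝ`. -/
theorem Ksub_split_epi {G H : Type*} [Group G] [Group H] {mG nH : ℕ}
    (genG : Fin mG → G) (genH : Fin nH → H)
    (hG : Subgroup.closure (Set.range genG) = ⊤)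
    (hH : Subgroup.closure (Set.range genH) = ⊤) (A : Set ℕ) :
    ∃ γ : ↥(Ksub genG A H) →* G,
      Function.Surjective γ ∧
      (∀ g : G, γ ⟨ghat genG A H g, ghat_mem genG A H g⟩ = g) ∧
      (∀ (h : H) (b : Bool), γ ⟨hbGen genG A h b, hb_mem genG A h b⟩ = 1) ∧
      ∃ s : G →* ↥(Ksub genG A H),
        (∀ g : G,
          ((s g : ↥(Ksub genG A H)) : Equiv.Perm (↥(XA genG A) × H)) = ghat genG A H g) ∧
        γ.comp s = MonoidHom.id G := by
  choose φ hφ using fun f : ↥(Ksub genG A H) => Ksub_exists_shift genG A f.1 f.2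
  have key : ∀ (f : ↥(Ksub genG A H)) (g : G),
      (∀ p, (f.1 p).1.1 = shiftC g p.1.1) → φ f = g := by
    intro f g hg
    refine shift_unique genG A _ _ fun x hx => ?_
    exact (hφ f (⟨x, hx⟩, 1)).symm.trans (hg (⟨x, hx⟩, 1))
  let γ : ↥(Ksub genG A H) →* G := MonoidHom.mk' φ (by
    intro a b
    refine key _ _ fun p => ?_
    rw [Subgroup.coe_mul, Equiv.Perm.mul_apply, hφ a, hφ b, shiftC_mul])
  have hγ : ∀ g : G, γ ⟨ghat genG A H g, ghat_mem genG A H g⟩ = g :=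
    fun g => key _ _ fun p => rfl
  let s : G →* ↥(Ksub genG A H) :=
    MonoidHom.mk' (fun g => ⟨ghat genG A H g, ghat_mem genG A H g⟩) (by
      intro a b
      apply Subtype.ext
      apply Equiv.ext
      intro p
      refine Prod.ext (Subtype.ext ?_) rfl
      exact (shiftC_mul a b p.1.1).symm)
  refine ⟨γ, fun g => ⟨_, hγ g⟩, hγ, ?_, s, fun g => rfl, MonoidHom.ext hγ⟩
  intro h b
  exact key _ _ fun p => (shiftC_one _).symm
end

section
/- Let G be a group with a finite generating set S_G and decidable word problem, and let A ⊆ ℕ be Σ⁰₁. Then X_A is an effective subshift: there exists a Σ⁰₁ set F of (codes of) patterns such that X_A = {x ∈ {0,1}^G : x matches no pattern of F at any g ∈ G}. -/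
/-- A Σ⁰₁ (recursively enumerable) subset of a `Primcodable` type. -/
def IsSigma01On {α : Type*} [Primcodable α] (S : Set α) : Prop :=
  ∃ f : α →. ℕ, Partrec f ∧ ∀ a, a ∈ S ↔ (f a).Dom

/-- A pattern: a finite list of pairs (word over the generators, bit). -/
abbrev GPattern (m : ℕ) := List (List (Fin m × Bool) × Bool)

/-- `x` matches the pattern `P` at `g`. -/
def MatchesAt {G : Type*} [Group G] {m : ℕ} (gen : Fin m → G) (x : G → Bool)
    (P : GPattern m) (g : G) : Prop :=
  ∀ pr ∈ P, x (g * evalWord gen pr.1) = pr.2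

/-- Formal inverse of a word. -/
def invWord {m : ℕ} (w : List (Fin m × Bool)) : List (Fin m × Bool) :=
  (w.map fun l => (l.1, !l.2)).reverse

theorem evalWord_append {K : Type*} [Group K] {m : ℕ} (gen : Fin m → K)
    (u v : List (Fin m × Bool)) :
    evalWord gen (u ++ v) = evalWord gen u * evalWord gen v := by
  simp [evalWord]

theorem evalWord_nil {K : Type*} [Group K] {m : ℕ} (gen : Fin m → K) :
    evalWord gen [] = 1 := rfl

theorem evalWord_inv {K : Type*} [Group K] {m : ℕ} (gen : Fin m → K)
    (u : List (Fin m × Bool)) :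
    evalWord gen (invWord u) = (evalWord gen u)⁻¹ := by
  induction u with
  | nil => simp [evalWord, invWord]
  | cons l u ih =>
    have h1 : invWord (l :: u) = invWord u ++ [(l.1, !l.2)] := by simp [invWord]
    have h2 : evalWord gen (l :: u) = evalWord gen [l] * evalWord gen u :=
      evalWord_append gen [l] u
    rw [h1, evalWord_append, ih, h2, mul_inv_rev]
    congr 1
    rcases l with ⟨i, b⟩
    cases b <;> simp [evalWord]

theorem evalWord_surj {K : Type*} [Group K] {m : ℕ} (gen : Fin m → K)
    (hG : Subgroup.closure (Set.range gen) = ⊤) (g : K) : ∃ w, evalWord gen w = g := by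
  have hg : g ∈ Subgroup.closure (Set.range gen) := by rw [hG]; trivial
  induction hg using Subgroup.closure_induction with
  | mem x hx =>
    obtain ⟨i, rfl⟩ := hx
    exact ⟨[(i, true)], by simp [evalWord]⟩
  | one => exact ⟨[], rfl⟩
  | mul x y _ _ hx hy =>
    obtain ⟨u, rfl⟩ := hx
    obtain ⟨v, rfl⟩ := hy
    exact ⟨u ++ v, evalWord_append _ _ _⟩
  | inv x _ hx =>
    obtain ⟨u, rfl⟩ := hx
    exact ⟨invWord u, evalWord_inv _ _⟩

theorem wordCode_concat {m : ℕ} (w : List (Fin m × Bool)) (l : Fin m × Bool) :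
    wordCode (w ++ [l]) =
      wordCode w * (2 * m) + (2 * l.1.val + (if l.2 then 1 else 0) + 1) := by
  simp [wordCode]

theorem wordCode_inj {m : ℕ} : Function.Injective (@wordCode m) := by
  intro u
  induction u using List.reverseRecOn with
  | nil =>
    intro v h
    rcases List.eq_nil_or_concat v with rfl | ⟨v', l, rfl⟩
    · rfl
    · rw [List.concat_eq_append, wordCode_concat] at h
      simp [wordCode] at h
  | append_singleton u l ih =>
    intro v h
    rcases List.eq_nil_or_concat v with rfl | ⟨v', l', rfl⟩
    · rw [wordCode_concat] at h
      simp [wordCode] at h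
    · rw [List.concat_eq_append] at h ⊢
      rw [wordCode_concat, wordCode_concat] at h
      obtain ⟨⟨i, hi⟩, b⟩ := l
      obtain ⟨⟨j, hj⟩, c⟩ := l'
      simp only at h
      have key : ∀ (a a' d d' : ℕ), d < 2 * m → d' < 2 * m →
          a * (2 * m) + (d + 1) = a' * (2 * m) + (d' + 1) → a = a' ∧ d = d' := by
        intro a a' d d' hd hd' he
        have he' : d + (2 * m) * a = d' + (2 * m) * a' := by
          rw [mul_comm _ a, mul_comm _ a']; omega
        have e1 : d = d' := by
          have := congrArg (· % (2 * m)) he'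
          simpa [Nat.add_mul_mod_self_left, Nat.mod_eq_of_lt hd, Nat.mod_eq_of_lt hd'] using this
        refine ⟨?_, e1⟩
        subst e1
        exact Nat.eq_of_mul_eq_mul_left (by omega : 0 < 2 * m) (Nat.add_left_cancel he')
      obtain ⟨h1, h2⟩ := key _ _ _ _ (by split_ifs <;> omega) (by split_ifs <;> omega) h
      rw [ih h1]
      have : i = j ∧ b = c := by
        cases b <;> cases c <;> simp at h2 ⊢ <;> omega
      obtain ⟨rfl, rfl⟩ := this
      rfl

theorem wordCode_mem {K : Type*} [Group K] {m : ℕ} (gen : Fin m → K)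
    (w : List (Fin m × Bool)) : wordCode w ∈ WordProblem gen ↔ evalWord gen w = 1 := by
  constructor
  · rintro ⟨w', h, h'⟩
    rwa [← wordCode_inj h]
  · intro h
    exact ⟨w, rfl, h⟩

/-- All words of length less than `n`. -/
noncomputable def shortWords (m : ℕ) (n : ℕ) : List (List (Fin m × Bool)) :=
  Nat.rec [] (fun _ L => [] :: L.flatMap fun w =>
    (Finset.univ : Finset (Fin m × Bool)).toList.map fun l => l :: w) n

theorem mem_shortWords {m n : ℕ} (w : List (Fin m × Bool)) :
    w ∈ shortWords m n ↔ w.length < n := by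
  induction n generalizing w with
  | zero => simp [shortWords]
  | succ n ih =>
    have : shortWords m (n + 1) = [] :: (shortWords m n).flatMap fun w =>
      (Finset.univ : Finset (Fin m × Bool)).toList.map fun l => l :: w := rfl
    rw [this]
    cases w with
    | nil => simp
    | cons l w => simp [ih]

theorem primrec_shortWords (m : ℕ) : Primrec (shortWords m) := by
  refine Primrec.nat_rec₁ (f := fun _ L => [] :: L.flatMap fun w =>
    (Finset.univ : Finset (Fin m × Bool)).toList.map fun l => l :: w) [] ?_
  refine Primrec.list_cons.comp (Primrec.const []) ?_
  refine Primrec.list_flatMap Primrec.snd ?_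
  refine Primrec.list_map (Primrec.const _) ?_
  exact Primrec.list_cons.comp Primrec.snd (Primrec.snd.comp Primrec.fst)

theorem primrec_wordCode (m : ℕ) : Primrec (@wordCode m) := by
  refine Primrec.list_foldl (h := fun _ (p : ℕ × (Fin m × Bool)) =>
    p.1 * (2 * m) + (2 * p.2.1.val + (if p.2.2 then 1 else 0) + 1)) Primrec.id (Primrec.const 0) ?_
  have hl : Primrec fun q : List (Fin m × Bool) × (ℕ × (Fin m × Bool)) => q.2.2 :=
    Primrec.snd.comp Primrec.snd
  refine Primrec.nat_add.comp (Primrec.nat_mul.comp (Primrec.fst.comp Primrec.snd)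
    (Primrec.const _)) ?_
  refine Primrec.succ.comp (Primrec.nat_add.comp (Primrec.nat_mul.comp (Primrec.const 2)
    (Primrec.fin_val.comp (Primrec.fst.comp hl))) ?_)
  exact Primrec.ite (Primrec.eq.comp (Primrec.snd.comp hl) (Primrec.const true))
    (Primrec.const 1) (Primrec.const 0)

theorem primrec_invWord (m : ℕ) : Primrec (@invWord m) := by
  refine Primrec.list_reverse.comp (Primrec.list_map Primrec.id ?_)
  exact Primrec.pair (Primrec.fst.comp Primrec.snd)
    (Primrec.not.comp (Primrec.snd.comp Primrec.snd))

theorem computable_all {d : ℕ → Bool} (hd : Computable d) :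
    Computable fun l : List ℕ => l.all fun n => !d n := by
  have h : Computable fun l : List ℕ => Nat.rec (motive := fun _ => Bool) true
      (fun k IH => IH && !d (l.getD k 0)) l.length := by
    refine Computable.nat_rec (h := fun (l : List ℕ) (p : ℕ × Bool) => p.2 && !d (l.getD p.1 0))
      Computable.list_length (Computable.const true) ?_
    refine Primrec.and.to_comp.comp (Computable.snd.comp Computable.snd) ?_
    refine Primrec.not.to_comp.comp (hd.comp ?_)
    exact (Primrec.list_getD 0).to_comp.comp Computable.fst (Computable.fst.comp Computable.snd)
  refine h.of_eq fun l => ?_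
  have key : ∀ k ≤ l.length, Nat.rec (motive := fun _ => Bool) true
      (fun k IH => IH && !d (l.getD k 0)) k = (l.take k).all fun n => !d n := by
    intro k hk
    induction k with
    | zero => simp
    | succ k ih =>
      have hk' : k < l.length := hk
      have ih' := ih hk'.le
      simp only [] at ih' ⊢
      rw [ih', List.take_succ_eq_append_getElem hk', List.all_append]
      simp [hk']
  simpa using key l.length le_rfl

/-- The word at position `k` of a pattern. -/
def patWord {m : ℕ} (P : GPattern m) (k : ℕ) : List (Fin m × Bool) := (P.getD k ([], true)).1

/-- Codes to be tested for pair patterns. -/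
noncomputable def codes2 {m : ℕ} (w : List (Fin m × Bool)) : List ℕ :=
  wordCode w :: (shortWords m w.length).map fun w' => wordCode (invWord w' ++ w)

/-- Codes to be tested for triple patterns. -/
def codes3 {m : ℕ} (u v : List (Fin m × Bool)) : List ℕ :=
  [wordCode u, wordCode v, wordCode (invWord u ++ v)]

theorem primrec_patWord {m : ℕ} (k : ℕ) : Primrec fun P : GPattern m => patWord P k :=
  Primrec.fst.comp ((Primrec.list_getD _).comp Primrec.id (Primrec.const k))

theorem primrec_quot (m : ℕ) :
    Primrec₂ fun u v : List (Fin m × Bool) => wordCode (invWord u ++ v) :=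
  (primrec_wordCode m).comp (Primrec.list_append.comp ((primrec_invWord m).comp Primrec.fst)
    Primrec.snd)

theorem primrec_codes2 (m : ℕ) : Primrec (@codes2 m) := by
  refine Primrec.list_cons.comp (primrec_wordCode m) ?_
  refine Primrec.list_map ((primrec_shortWords m).comp Primrec.list_length) ?_
  exact (primrec_quot m).comp Primrec.snd Primrec.fst

theorem primrec_codes3 (m : ℕ) : Primrec₂ (@codes3 m) := by
  refine Primrec.list_cons.comp ((primrec_wordCode m).comp Primrec.fst) ?_
  refine Primrec.list_cons.comp ((primrec_wordCode m).comp Primrec.snd) ?_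
  exact Primrec.list_cons.comp ((primrec_quot m).comp Primrec.fst Primrec.snd) (Primrec.const [])

theorem primrec_entry (m : ℕ) :
    Primrec fun w : List (Fin m × Bool) => (w, true) :=
  Primrec.pair Primrec.id (Primrec.const true)

/-- Shape test for pair patterns. -/
def shape2 {m : ℕ} (P : GPattern m) : Bool := decide (P = [([], true), (patWord P 1, true)])

/-- Shape test for triple patterns. -/
def shape3 {m : ℕ} (P : GPattern m) : Bool :=
  decide (P = [([], true), (patWord P 1, true), (patWord P 2, true)])

theorem primrec_shape2 (m : ℕ) : Primrec (@shape2 m) := by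
  refine (PrimrecRel.decide (Primrec.eq (α := GPattern m))).comp Primrec.id ?_
  refine Primrec.list_cons.comp (Primrec.const _) ?_
  exact Primrec.list_cons.comp ((primrec_entry m).comp (primrec_patWord 1)) (Primrec.const [])

theorem primrec_shape3 (m : ℕ) : Primrec (@shape3 m) := by
  refine (PrimrecRel.decide (Primrec.eq (α := GPattern m))).comp Primrec.id ?_
  refine Primrec.list_cons.comp (Primrec.const _) ?_
  refine Primrec.list_cons.comp ((primrec_entry m).comp (primrec_patWord 1)) ?_
  exact Primrec.list_cons.comp ((primrec_entry m).comp (primrec_patWord 2)) (Primrec.const [])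

theorem quot_ne {K : Type*} [Group K] {m : ℕ} (gen : Fin m → K) (u v : List (Fin m × Bool)) :
    wordCode (invWord u ++ v) ∉ WordProblem gen ↔ evalWord gen u ≠ evalWord gen v := by
  rw [wordCode_mem, evalWord_append, evalWord_inv, ne_eq, inv_mul_eq_one]

theorem codes2_iff {K : Type*} [Group K] {m : ℕ} (gen : Fin m → K) (w : List (Fin m × Bool)) :
    (∀ n ∈ codes2 w, n ∉ WordProblem gen) ↔
      evalWord gen w ≠ 1 ∧ wordNorm gen (evalWord gen w) = w.length := by
  have h0 : (∀ n ∈ codes2 w, n ∉ WordProblem gen) ↔ evalWord gen w ≠ 1 ∧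
      ∀ w' : List (Fin m × Bool), w'.length < w.length → evalWord gen w' ≠ evalWord gen w := by
    simp only [codes2, List.forall_mem_cons, List.forall_mem_map, evalWord_append, evalWord_inv, inv_mul_eq_one, mem_shortWords,
      wordCode_mem]
  rw [h0]
  refine and_congr_right fun _ => ?_
  constructor
  · intro h
    have hle : wordNorm gen (evalWord gen w) ≤ w.length := Nat.sInf_le ⟨w, rfl, rfl⟩
    obtain ⟨w', h1, h2⟩ : wordNorm gen (evalWord gen w) ∈
        { ℓ | ∃ w' : List (Fin m × Bool), w'.length = ℓ ∧ evalWord gen w' = evalWord gen w } :=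
      Nat.sInf_mem ⟨_, w, rfl, rfl⟩
    by_contra hne
    exact h w' (by omega) h2
  · intro h w' hlt he
    have : wordNorm gen (evalWord gen w) ≤ w'.length := Nat.sInf_le ⟨w', rfl, he⟩
    omega

/-- If `G` has decidable word problem and `A` is Σ⁰₁, then `X_A`
is an effective subshift: it is defined by a Σ⁰₁ family of forbidden patterns. -/
theorem XA_effective {G : Type*} [Group G] {m : ℕ} (genG : Fin m → G)
    (hG : Subgroup.closure (Set.range genG) = ⊤)
    (hdec : ComputablePred (· ∈ WordProblem genG))
    (A : Set ℕ) (hA : IsSigma01 A) :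
    ∃ F : Set (GPattern m), IsSigma01On F ∧
      ∀ x : G → Bool, x ∈ XA genG A ↔ ∀ P ∈ F, ∀ g : G, ¬ MatchesAt genG x P g := by
  classical
  obtain ⟨hd, hdc⟩ := hdec
  obtain ⟨f, hf, hfA⟩ := hA
  let d : ℕ → Bool := fun n => decide (n ∈ WordProblem genG)
  have hall := computable_all (d := d) hdc
  let c2 : GPattern m → Bool := fun P =>
    shape2 P && (codes2 (patWord P 1)).all fun n => !d n
  let c3 : GPattern m → Bool := fun P =>
    shape3 P && (codes3 (patWord P 1) (patWord P 2)).all fun n => !d n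
  have hc2 : Computable c2 := Primrec.and.to_comp.comp (primrec_shape2 m).to_comp
    (hall.comp ((primrec_codes2 m).comp (primrec_patWord 1)).to_comp)
  have hc3 : Computable c3 := Primrec.and.to_comp.comp (primrec_shape3 m).to_comp
    (hall.comp ((primrec_codes3 m).comp (primrec_patWord 1) (primrec_patWord 2)).to_comp)
  let Φ : GPattern m →. ℕ := fun P =>
    cond (c3 P) (Part.some 0) (cond (c2 P) (f (patWord P 1).length) Part.none)
  have hΦ : Partrec Φ := by
    refine Partrec.cond hc3 (Computable.const 0) (Partrec.cond hc2 ?_ Partrec.none)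
    exact hf.comp (Computable.list_length.comp (primrec_patWord 1).to_comp)
  have hc2' : ∀ P, c2 P = true ↔ ∃ w, P = [([], true), (w, true)] ∧ evalWord genG w ≠ 1 ∧
      wordNorm genG (evalWord genG w) = w.length ∧ w = patWord P 1 := by
    intro P
    have h1 : c2 P = true ↔ P = [([], true), (patWord P 1, true)] ∧
        ∀ n ∈ codes2 (patWord P 1), n ∉ WordProblem genG := by
      simp [c2, d, shape2]
    rw [h1, codes2_iff]
    constructor
    · rintro ⟨h, h', h''⟩
      exact ⟨_, h, h', h'', rfl⟩
    · rintro ⟨w, h, h', h'', rfl⟩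
      exact ⟨h, h', h''⟩
  have hc3' : ∀ P, c3 P = true ↔ ∃ u v, P = [([], true), (u, true), (v, true)] ∧
      evalWord genG u ≠ 1 ∧ evalWord genG v ≠ 1 ∧ evalWord genG u ≠ evalWord genG v := by
    intro P
    have h1 : c3 P = true ↔ P = [([], true), (patWord P 1, true), (patWord P 2, true)] ∧
        ∀ n ∈ codes3 (patWord P 1) (patWord P 2), n ∉ WordProblem genG := by
      simp [c3, d, shape3]
    have h2 : ∀ u v : List (Fin m × Bool), (∀ n ∈ codes3 u v, n ∉ WordProblem genG) ↔
        evalWord genG u ≠ 1 ∧ evalWord genG v ≠ 1 ∧ evalWord genG u ≠ evalWord genG v := by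
      intro u v
      simp only [codes3, List.forall_mem_cons, evalWord_append, evalWord_inv, inv_mul_eq_one, wordCode_mem]
      simp
    rw [h1, h2]
    constructor
    · rintro ⟨h, h'⟩
      exact ⟨_, _, h, h'⟩
    · rintro ⟨u, v, rfl, h'⟩
      exact ⟨rfl, h'⟩
  refine ⟨{P | (Φ P).Dom}, ⟨Φ, hΦ, fun _ => Iff.rfl⟩, ?_⟩
  intro x
  constructor
  · rintro ⟨hx1, hx2⟩ P hP g hM
    change (Φ P).Dom at hP
    rcases h3 : c3 P with _ | _
    · rcases h2 : c2 P with _ | _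
      · simp [Φ, h3, h2] at hP
      · simp only [Φ, h3, h2, cond_true, cond_false] at hP
        rw [← hfA] at hP
        obtain ⟨w, hPw, hw1, hwn, hw⟩ := (hc2' P).1 h2
        rw [← hw] at hP
        rw [hPw] at hM
        have e1 := hM ([], true) (by simp)
        have e2 := hM (w, true) (by simp)
        simp only [evalWord_nil, mul_one] at e1
        refine hx2 g (g * evalWord genG w) e1 e2 (by simpa using hw1) ?_
        rw [wordDist, inv_mul_cancel_left, hwn]
        exact hP
    · obtain ⟨u, v, rfl, hu, hv, huv⟩ := (hc3' P).1 h3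
      have e1 := hM ([], true) (by simp)
      have e2 := hM (u, true) (by simp)
      have e3 := hM (v, true) (by simp)
      simp only [evalWord_nil, mul_one] at e1
      rcases hx1 _ _ _ e1 e2 e3 with h | h | h
      · exact hu (by simpa using h)
      · exact hv (by simpa using h)
      · exact huv (mul_left_cancel h)
  · intro H
    constructor
    · intro a b c ha hb hc
      by_contra hne
      push Not at hne
      obtain ⟨hab, hac, hbc⟩ := hne
      obtain ⟨u, hu⟩ := evalWord_surj genG hG (a⁻¹ * b)
      obtain ⟨v, hv⟩ := evalWord_surj genG hG (a⁻¹ * c)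
      have h3 : c3 [([], true), (u, true), (v, true)] = true := by
        refine (hc3' _).2 ⟨u, v, rfl, ?_, ?_, ?_⟩
        · rw [hu]; simpa [inv_mul_eq_one] using hab
        · rw [hv]; simpa [inv_mul_eq_one] using hac
        · rw [hu, hv]; simpa using hbc
      refine H [([], true), (u, true), (v, true)] ?_ a ?_
      · change (Φ _).Dom
        simp [Φ, h3]
      · simp [MatchesAt, evalWord_nil, hu, hv, ha, hb, hc]
    · intro a b ha hb hab hA
      obtain ⟨w0, hw0⟩ := evalWord_surj genG hG (a⁻¹ * b)
      obtain ⟨w, hwl, hw⟩ : wordNorm genG (a⁻¹ * b) ∈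
          { ℓ | ∃ w' : List (Fin m × Bool), w'.length = ℓ ∧ evalWord genG w' = a⁻¹ * b } :=
        Nat.sInf_mem ⟨_, w0, rfl, hw0⟩
      have h2 : c2 [([], true), (w, true)] = true := by
        refine (hc2' _).2 ⟨w, rfl, ?_, ?_, rfl⟩
        · rw [hw]; simpa [inv_mul_eq_one] using hab
        · rw [hw, hwl]
      refine H [([], true), (w, true)] ?_ a ?_
      · change (Φ _).Dom
        rcases h3 : c3 [([], true), (w, true)] with _ | _
        · simp only [Φ, h3, h2, cond_true, cond_false]
          rw [← hfA]
          change w.length ∈ A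
          rw [hwl]
          exact hA
        · simp [Φ, h3]
      · simp [MatchesAt, evalWord_nil, hw, ha, hb]
end

section
/- Let G and H be finitely generated groups with decidable word problems, and let A ⊆ ℕ. Then WP(K(G,A,H)) (with respect to the distinguished generating set of K(G,A,H)) conjunctively reduces to A with some rate β that grows exponentially: there is c > 1 such that β(n) ≥ cⁿ for all sufficiently large n. -/
/-- The distinguished generating set of `K(G,A,H)`:
the `ĝ` for `g` among the generators of `G`, and the `h_b` for `h` among
the generators of `H` and `b ∈ {0,1}`. -/
def genKGen {G H : Type*} [Group G] [Group H] {mG nH : ℕ}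
    (genG : Fin mG → G) (genH : Fin nH → H) (A : Set ℕ) :
    Fin (mG + 2 * nH) → ↥(Ksub genG A H) := fun i =>
  if h : (i : ℕ) < mG then ⟨ghat genG A H (genG ⟨i, h⟩), ghat_mem genG A H _⟩
  else
    ⟨hbGen genG A (genH ⟨((i : ℕ) - mG) / 2, by have := i.isLt; omega⟩)
        (decide (((i : ℕ) - mG) % 2 = 1)),
      hb_mem genG A _ _⟩


namespace KConj

section Comp
variable {α β σ : Type*} [Primcodable α] [Primcodable β] [Primcodable σ]

theorem comp_foldl {f : α → List β} {g : α → σ} {h : α → σ × β → σ}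
    (hf : Computable f) (hg : Computable g) (hh : Computable₂ h) :
    Computable fun a => (f a).foldl (fun s b => h a (s, b)) (g a) := by
  have key : Computable fun a => Nat.rec (motive := fun _ => σ) (g a)
      (fun y IH => (fun (a : α) (p : ℕ × σ) =>
        Option.casesOn (motive := fun _ => σ) ((f a)[p.1]?) p.2 (fun b => h a (p.2, b))) a (y, IH))
      ((f a).length) := by
    refine Computable.nat_rec (f := fun a => (f a).length) (g := g) (h := fun (a : α) (p : ℕ × σ) =>
        Option.casesOn (motive := fun _ => σ) ((f a)[p.1]?) p.2 (fun b => h a (p.2, b)))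
      (Computable.list_length.comp hf) hg ?_
    refine Computable.option_casesOn (o := fun q : α × ℕ × σ => (f q.1)[q.2.1]?)
      (f := fun q => q.2.2) (g := fun q b => h q.1 (q.2.2, b)) ?_ ?_ ?_
    · exact Computable.list_getElem?.comp (hf.comp Computable.fst)
        (Computable.fst.comp Computable.snd)
    · exact Computable.snd.comp Computable.snd
    · exact hh.comp (Computable.fst.comp Computable.fst)
        (Computable.pair (Computable.snd.comp (Computable.snd.comp Computable.fst)) Computable.snd)
  refine key.of_eq fun a => ?_
  have : ∀ k, Nat.rec (motive := fun _ => σ) (g a)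
      (fun y IH => (fun (a : α) (p : ℕ × σ) =>
        Option.casesOn (motive := fun _ => σ) ((f a)[p.1]?) p.2 (fun b => h a (p.2, b))) a (y, IH))
      k = ((f a).take k).foldl (fun s b => h a (s, b)) (g a) := by
    intro k
    induction k with
    | zero => simp
    | succ k ih =>
      rw [List.take_add_one, List.foldl_append, ← ih]
      dsimp only
      cases (f a)[k]? <;> simp
  rw [this, List.take_length]

theorem comp_foldr {f : α → List β} {g : α → σ} {h : α → β × σ → σ}
    (hf : Computable f) (hg : Computable g) (hh : Computable₂ h) :
    Computable fun a => (f a).foldr (fun b s => h a (b, s)) (g a) := by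
  have := comp_foldl (f := fun a => (f a).reverse) (g := g) (h := fun a p => h a (p.2, p.1))
    (Computable.list_reverse.comp hf) hg
    (hh.comp Computable.fst (Computable.pair (Computable.snd.comp Computable.snd)
      (Computable.fst.comp Computable.snd)))
  refine this.of_eq fun a => ?_
  rw [List.foldl_reverse]

theorem comp_and {p q : α → Bool} (hp : Computable p) (hq : Computable q) :
    Computable fun a => p a && q a := Primrec.and.to_comp.comp hp hq

theorem comp_or {p q : α → Bool} (hp : Computable p) (hq : Computable q) :
    Computable fun a => p a || q a := Primrec.or.to_comp.comp hp hq

theorem comp_not {p : α → Bool} (hp : Computable p) :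
    Computable fun a => !p a := Primrec.not.to_comp.comp hp

theorem comp_any {f : α → List β} {p : α → β → Bool} (hf : Computable f) (hp : Computable₂ p) :
    Computable fun a => (f a).any (p a) := by
  have := comp_foldr (f := f) (g := fun _ => false) (h := fun a q => p a q.1 || q.2) hf
    (Computable.const false)
    (comp_or (hp.comp Computable.fst (Computable.fst.comp Computable.snd))
      (Computable.snd.comp Computable.snd))
  refine this.of_eq fun a => ?_
  induction f a with
  | nil => rfl
  | cons b l ih => simp only [List.foldr_cons, List.any_cons, ih]

theorem comp_all {f : α → List β} {p : α → β → Bool} (hf : Computable f) (hp : Computable₂ p) :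
    Computable fun a => (f a).all (p a) := by
  refine (comp_not (comp_any hf (p := fun a b => !p a b) (comp_not hp))).of_eq fun a => ?_
  induction f a with
  | nil => rfl
  | cons b l ih => simp_all [List.any_cons, List.all_cons]

theorem comp_map {f : α → List β} {g : α → β → σ} (hf : Computable f) (hg : Computable₂ g) :
    Computable fun a => (f a).map (g a) := by
  have := comp_foldr (f := f) (g := fun _ => ([] : List σ)) (h := fun a q => g a q.1 :: q.2) hf
    (Computable.const [])
    (Computable.list_cons.comp (hg.comp Computable.fst (Computable.fst.comp Computable.snd))
      (Computable.snd.comp Computable.snd))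
  refine this.of_eq fun a => ?_
  induction f a with
  | nil => rfl
  | cons b l ih => simp only [List.foldr_cons, List.map_cons, ih]

/-- unbounded search -/
theorem comp_search {p : α → ℕ → Bool} (hp : Computable₂ p) (F : α → ℕ)
    (h1 : ∀ a, p a (F a) = true) (h2 : ∀ a k, k < F a → p a k = false) : Computable F := by
  have := Partrec.rfind (p := fun a n => (Part.some (p a n))) hp.partrec₂
  refine this.of_eq fun a => ?_
  apply Part.eq_some_iff.2
  refine Nat.mem_rfind.2 ⟨?_, ?_⟩
  · simp [h1]
  · intro m hm
    simp [h2 a m hm]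

/-- a computable bijection onto `ℕ` has a computable inverse -/
theorem comp_inverse (f : β → ℕ) (hf : Computable f) (hi : Function.Injective f)
    (r : ℕ → β) (hr : ∀ n, f (r n) = n) : Computable r := by
  have h0 : Computable₂ fun (n e : ℕ) => (Encodable.decode (α := β) e).bind
      (fun b => bif f b == n then some b else none) := by
    refine Computable.option_bind (f := fun q : ℕ × ℕ => Encodable.decode (α := β) q.2)
        (g := fun q b => bif f b == q.1 then some b else none) ?_ ?_
    · exact Computable.decode.comp Computable.snd
    · exact Computable.cond (Primrec.beq.to_comp.comp (hf.comp Computable.snd)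
          (Computable.fst.comp Computable.fst)) (Computable.option_some.comp Computable.snd)
          (Computable.const none)
  have := Partrec.rfindOpt h0
  refine this.of_eq fun n => ?_
  apply Part.eq_some_iff.2
  have hd : (Nat.rfindOpt fun e => (Encodable.decode (α := β) e).bind
      (fun b => bif f b == n then some b else none)).Dom := by
    rw [Nat.rfindOpt_dom]
    exact ⟨Encodable.encode (r n), r n, by simp [hr]⟩
  obtain ⟨x, hx⟩ := Part.dom_iff_mem.1 hd
  obtain ⟨e, he⟩ := Nat.rfindOpt_spec hx
  have hxe : x = r n := by
    rw [Option.mem_def, Option.bind_eq_some_iff] at he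
    obtain ⟨b, -, hb⟩ := he
    apply hi
    rw [hr]
    by_cases h : f b = n
    · simp [h] at hb
      rw [← hb, h]
    · have : (f b == n) = false := by simpa using h
      simp [this] at hb
  rw [← hxe]
  exact hx

end Comp

theorem bitLE_iff (w u : List Bool) : bitLE w u ↔ w.length = u.length ∧
    ∀ j, w.getD j false = true → u.getD j false = true := by
  unfold bitLE
  rw [List.forall₂_iff_get]
  constructor
  · rintro ⟨h, h'⟩
    refine ⟨h, fun j hj => ?_⟩
    by_cases hlt : j < w.length
    · have := h' j hlt (h ▸ hlt)
      simp only [List.get_eq_getElem] at this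
      rw [List.getD_eq_getElem _ _ hlt] at hj
      rw [List.getD_eq_getElem _ _ (h ▸ hlt)]
      rw [hj] at this
      exact Bool.le_iff_imp.1 this rfl
    · rw [List.getD_eq_default _ _ (by omega)] at hj
      simp at hj
  · rintro ⟨h, h'⟩
    refine ⟨h, fun j h1 h2 => ?_⟩
    have := h' j
    rw [List.getD_eq_getElem _ _ h1, List.getD_eq_getElem _ _ h2] at this
    simp only [List.get_eq_getElem]
    exact Bool.le_iff_imp.2 this

/-- The final bookkeeping: conjunctive queries of logarithmic size give exponential rate. -/
theorem conj_of_queries (A B : Set ℕ) (st : ℕ → Bool) (D : ℕ → ℕ → Bool)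
    (hst : Computable st) (hD : Computable₂ D)
    (hB : ∀ i, i ∈ B ↔ st i = true ∧ ∀ j, D i j = true → j ∈ A)
    (hlen : ∀ i j, st i = true → D i j = true → 2 ^ j ≤ i + 1) :
    ∃ β : ℕ → ℕ, ConjRedRate B A β ∧
      ∃ c : ℝ, 1 < c ∧ ∃ N : ℕ, ∀ n ≥ N, c ^ n ≤ (β n : ℝ) := by
  have hβ : Computable fun m : ℕ => 2 ^ m - 1 := by
    have h2 : Primrec fun m : ℕ => Nat.rec (motive := fun _ => ℕ) 1 (fun _ ih => 2 * ih) m :=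
      Primrec.nat_rec₁ 1 (Primrec.nat_mul.comp (Primrec.const 2) Primrec.snd)
    have : Primrec fun m : ℕ => 2 ^ m - 1 := by
      refine (Primrec.nat_sub.comp h2 (Primrec.const 1)).of_eq fun m => ?_
      congr 1
      induction m with
      | zero => rfl
      | succ m ih => simp only [ih]; ring
    exact this.to_comp
  let bit : List Bool → ℕ → Bool := fun u i =>
    st i && (List.range u.length).all (fun j => !D i j || u.getD j false)
  have bit_iff : ∀ u i, bit u i = true ↔
      st i = true ∧ ∀ j < u.length, D i j = true → u.getD j false = true := by
    intro u i
    simp only [bit, Bool.and_eq_true, List.all_eq_true, List.mem_range, Bool.or_eq_true,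
      Bool.not_eq_true']
    refine and_congr_right fun _ => forall_congr' fun j => imp_congr_right fun _ => ?_
    cases D i j <;> simp
  have hbit : Computable₂ bit := by
    refine comp_and (hst.comp Computable.snd) (comp_all (f := fun q : List Bool × ℕ =>
      List.range q.1.length) (p := fun q j => !D q.2 j || q.1.getD j false) ?_ ?_)
    · exact Primrec.list_range.to_comp.comp (Computable.list_length.comp Computable.fst)
    · refine comp_or (comp_not (hD.comp (Computable.snd.comp Computable.fst) Computable.snd)) ?_
      exact (Primrec.list_getD false).to_comp.comp (Computable.fst.comp Computable.fst)
        Computable.snd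
  refine ⟨fun m => 2 ^ m - 1, ⟨hβ, ?_, ?_, fun u => (List.range (2 ^ u.length - 1)).map (bit u),
    ?_, ?_, ?_, ?_, fun i m => (List.range m).map (D i), ?_, ?_, ?_⟩, 3 / 2, by norm_num, 2, ?_⟩
  · intro a b hab
    exact Nat.sub_le_sub_right (Nat.pow_le_pow_right (by norm_num) hab) 1
  · refine Filter.tendsto_atTop_mono (fun n => ?_) Filter.tendsto_id
    have := Nat.lt_two_pow_self (n := n)
    simp only [id]
    omega
  · exact comp_map (f := fun u : List Bool => List.range (2 ^ u.length - 1))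
      (Primrec.list_range.to_comp.comp (hβ.comp Computable.list_length)) hbit
  · intro w
    simp
  · intro u v huv
    have hl : u.length = v.length := List.Forall₂.length_eq huv
    rw [bitLE_iff] at huv ⊢
    refine ⟨by simp [hl], fun j hj => ?_⟩
    by_cases hlt : j < 2 ^ u.length - 1
    · rw [List.getD_eq_getElem _ _ (by simpa using hlt)] at hj
      rw [List.getD_eq_getElem _ _ (by simpa [← hl] using hlt)]
      simp only [List.getElem_map, List.getElem_range] at hj ⊢
      rw [bit_iff] at hj ⊢
      exact ⟨hj.1, fun k hk hD => huv.2 k (hj.2 k (hl ▸ hk) hD)⟩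
    · rw [List.getD_eq_default _ _ (by simp; omega)] at hj
      simp at hj
  · intro m
    have hl : (charPrefix A m).length = m := by simp [charPrefix]
    beta_reduce
    rw [hl]
    conv_rhs => unfold charPrefix
    refine List.map_congr_left fun i hi => ?_
    rw [List.mem_range] at hi
    rw [Bool.eq_iff_iff, bit_iff, hl]
    rw [show (charSeq B i = true ↔ i ∈ B) by simp [charSeq], hB]
    have hg : ∀ j < m, ((charPrefix A m).getD j false = true ↔ j ∈ A) := by
      intro j hj
      rw [List.getD_eq_getElem _ _ (by rw [hl]; exact hj)]
      simp [charPrefix, charSeq]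
    refine and_congr_right fun hs => ?_
    constructor
    · intro h j hj
      have h1 := hlen i j hs hj
      have : j < m := by
        rw [← Nat.pow_lt_pow_iff_right (a := 2) (by norm_num)]
        omega
      exact (hg j this).1 (h j this hj)
    · intro h j hj hD
      exact (hg j hj).2 (h j hD)
  · exact comp_map (f := fun q : ℕ × ℕ => List.range q.2) (g := fun q j => D q.1 j)
      (Primrec.list_range.to_comp.comp Computable.snd)
      (hD.comp (Computable.fst.comp Computable.fst) Computable.snd)
  · simp
  · intro u v i huv h
    have hb : ∀ u : List Bool, bit u i = true ↔
        st i = true ∧ bitLE ((List.range u.length).map (D i)) u := by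
      intro u
      rw [bit_iff, bitLE_iff]
      refine and_congr_right fun _ => ?_
      simp only [List.length_map, List.length_range, true_and]
      refine forall_congr' fun j => ?_
      by_cases hj : j < u.length
      · simp [hj, List.getD]
      · simp [hj, List.getD]
    by_cases hlt : i < 2 ^ u.length - 1
    · rw [List.getD_eq_getElem _ _ (by simpa using hlt),
        List.getD_eq_getElem _ _ (by simpa [← huv] using hlt)]
      simp only [List.getElem_map, List.getElem_range]
      rw [Bool.eq_iff_iff, hb, hb, ← huv]
      exact and_congr_right fun _ => h
    · rw [List.getD_eq_default _ _ (by simp; omega),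
        List.getD_eq_default _ _ (by simp [← huv]; omega)]
  · intro n hn
    have : (((2 ^ n - 1 : ℕ)) : ℝ) = 2 ^ n - 1 := by
      rw [Nat.cast_sub (Nat.one_le_two_pow)]
      simp
    rw [this]
    induction n, hn using Nat.le_induction with
    | base => norm_num
    | succ n hn ih =>
      have := ih (by rw [Nat.cast_sub (Nat.one_le_two_pow)]; simp)
      have h1 : (1 : ℝ) ≤ 2 ^ n := one_le_pow₀ (by norm_num)
      rw [pow_succ, pow_succ]
      linarith

/-! ### Word codes -/

theorem wordCode_append {m : ℕ} (w : List (Fin m × Bool)) (l : Fin m × Bool) :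
    wordCode (w ++ [l]) = wordCode w * (2 * m) + (2 * l.1.val + (if l.2 then 1 else 0) + 1) := by
  simp [wordCode]

theorem wordCode_injective {m : ℕ} : Function.Injective (wordCode (m := m)) := by
  intro w
  induction w using List.reverseRecOn with
  | nil =>
    intro v h
    induction v using List.reverseRecOn with
    | nil => rfl
    | append_singleton v l _ =>
      rw [wordCode_append] at h
      simp [wordCode] at h
  | append_singleton w l ih =>
    intro v h
    induction v using List.reverseRecOn with
    | nil =>
      rw [wordCode_append] at h
      simp [wordCode] at h
    | append_singleton v k _ =>
      rw [wordCode_append, wordCode_append] at h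
      obtain ⟨⟨a, ha⟩, b⟩ := l
      obtain ⟨⟨c, hc⟩, d⟩ := k
      simp only at h
      have hb : (2 * a + if b = true then 1 else 0) < 2 * m := by split_ifs <;> omega
      have hd : (2 * c + if d = true then 1 else 0) < 2 * m := by split_ifs <;> omega
      have h' : wordCode w * (2 * m) + (2 * a + if b = true then 1 else 0)
        = wordCode v * (2 * m) + (2 * c + if d = true then 1 else 0) := by omega
      have hm : 0 < 2 * m := by omega
      have e1 := congrArg (· / (2 * m)) h'
      have e2 := congrArg (· % (2 * m)) h'
      simp only [Nat.mul_add_mod', Nat.mod_eq_of_lt hb, Nat.mod_eq_of_lt hd] at e2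
      simp only [mul_comm _ (2 * m), Nat.mul_add_div hm, Nat.div_eq_of_lt hb,
        Nat.div_eq_of_lt hd, add_zero] at e1
      have hwv := ih e1
      subst hwv
      have hac : a = c := by split_ifs at e2 <;> omega
      subst hac
      have hbd : b = d := by cases b <;> cases d <;> simp_all
      rw [hbd]

theorem wordCode_surjective {m : ℕ} (hm : 0 < m) : Function.Surjective (wordCode (m := m)) := by
  intro n
  induction n using Nat.strong_induction_on with
  | _ n ih =>
    rcases Nat.eq_zero_or_pos n with rfl | hn
    · exact ⟨[], rfl⟩
    · have hm2 : 0 < 2 * m := by omega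
      have hq : (n - 1) / (2 * m) < n := lt_of_le_of_lt (Nat.div_le_self _ _) (by omega)
      obtain ⟨w, hw⟩ := ih _ hq
      have hr := Nat.mod_lt (n - 1) hm2
      refine ⟨w ++ [(⟨(n - 1) % (2 * m) / 2, by omega⟩,
        decide ((n - 1) % (2 * m) % 2 = 1))], ?_⟩
      rw [wordCode_append, hw]
      have h1 := Nat.div_add_mod (n - 1) (2 * m)
      have h2 := Nat.div_add_mod ((n - 1) % (2 * m)) 2
      have h3 : (if decide ((n - 1) % (2 * m) % 2 = 1) = true then 1 else 0)
        = (n - 1) % (2 * m) % 2 := by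
        simp only [decide_eq_true_eq]
        split_ifs <;> omega
      rw [h3, mul_comm _ (2 * m)]
      simp only
      omega

theorem wordCode_length {m : ℕ} (w : List (Fin m × Bool)) : 2 ^ w.length ≤ wordCode w + 1 := by
  induction w using List.reverseRecOn with
  | nil => simp [wordCode]
  | append_singleton w l ih =>
    rw [wordCode_append]
    have hm : 1 ≤ m := by have := l.1.isLt; omega
    have h1 : wordCode w * 2 ≤ wordCode w * (2 * m) := Nat.mul_le_mul_left _ (by omega)
    simp only [List.length_append, List.length_singleton, pow_succ]
    omega

theorem wordCode_comp {m : ℕ} : Computable (wordCode (m := m)) := by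
  have : Primrec fun w : List (Fin m × Bool) => w.foldl (fun acc l => (fun (_ : List (Fin m × Bool))
      (q : ℕ × (Fin m × Bool)) => q.1 * (2 * m) +
        (fun l : Fin m × Bool => 2 * l.1.val + (if l.2 then 1 else 0) + 1) q.2) w (acc, l)) 0 := by
    refine Primrec.list_foldl (f := fun w : List (Fin m × Bool) => w) (g := fun _ => 0)
      (h := fun _ q => q.1 * (2 * m) +
        (fun l : Fin m × Bool => 2 * l.1.val + (if l.2 then 1 else 0) + 1) q.2)
      Primrec.id (Primrec.const 0) ?_
    exact Primrec.nat_add.comp (Primrec.nat_mul.comp (Primrec.fst.comp Primrec.snd)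
      (Primrec.const _)) ((Primrec.dom_finite (fun l : Fin m × Bool =>
        2 * l.1.val + (if l.2 then 1 else 0) + 1)).comp (Primrec.snd.comp Primrec.snd))
  exact this.to_comp

/-! ### Words in a group -/

section Words
variable {K : Type*} [Group K] {m : ℕ} (gen : Fin m → K)

theorem evalWord_nil : evalWord gen [] = 1 := rfl

theorem evalWord_append (u v : List (Fin m × Bool)) :
    evalWord gen (u ++ v) = evalWord gen u * evalWord gen v := by
  simp [evalWord]

theorem evalWord_cons (l : Fin m × Bool) (v : List (Fin m × Bool)) :
    evalWord gen (l :: v) = (if l.2 then gen l.1 else (gen l.1)⁻¹) * evalWord gen v := by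
  simp [evalWord]

/-- formal inverse -/
def invWord (w : List (Fin m × Bool)) : List (Fin m × Bool) :=
  (w.map fun l => (l.1, !l.2)).reverse

theorem evalWord_inv (w : List (Fin m × Bool)) :
    evalWord gen (invWord w) = (evalWord gen w)⁻¹ := by
  induction w with
  | nil => simp [invWord, evalWord]
  | cons l w ih =>
    have : invWord (l :: w) = invWord w ++ [(l.1, !l.2)] := by simp [invWord]
    rw [this, evalWord_append, ih, evalWord_cons gen l w, mul_inv_rev]
    congr 1
    rcases l with ⟨a, b⟩
    cases b <;> simp [evalWord]

theorem invWord_length (w : List (Fin m × Bool)) : (invWord w).length = w.length := by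
  simp [invWord]

theorem invWord_comp : Computable (invWord (m := m)) :=
  Computable.list_reverse.comp (comp_map (f := fun w : List (Fin m × Bool) => w)
    (g := fun _ l => (fun l : Fin m × Bool => (l.1, !l.2)) l) Computable.id
    ((Primrec.dom_finite (fun l : Fin m × Bool => (l.1, !l.2))).to_comp.comp Computable.snd))

theorem norm_le (w : List (Fin m × Bool)) : wordNorm gen (evalWord gen w) ≤ w.length :=
  Nat.sInf_le ⟨w, rfl, rfl⟩

theorem norm_inv (g : K) : wordNorm gen g⁻¹ = wordNorm gen g := by
  unfold wordNorm
  congr 1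
  ext n
  constructor
  · rintro ⟨w, hw, h⟩
    exact ⟨invWord w, by rw [invWord_length, hw], by rw [evalWord_inv, h, inv_inv]⟩
  · rintro ⟨w, hw, h⟩
    exact ⟨invWord w, by rw [invWord_length, hw], by rw [evalWord_inv, h]⟩

open Classical in
theorem triv_comp (hdec : ComputablePred (· ∈ WordProblem gen)) :
    Computable fun w : List (Fin m × Bool) => decide (evalWord gen w = 1) := by
  obtain ⟨f, hf, he⟩ := ComputablePred.computable_iff.1 hdec
  refine (hf.comp wordCode_comp).of_eq fun w => ?_
  rw [Bool.eq_iff_iff, decide_eq_true_iff, ← congrFun he (wordCode w)]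
  constructor
  · rintro ⟨v, hv, h⟩
    rwa [← wordCode_injective hv]
  · intro h
    exact ⟨w, rfl, h⟩

open Classical in
theorem eq_comp (hdec : ComputablePred (· ∈ WordProblem gen)) :
    Computable₂ fun u v : List (Fin m × Bool) => decide (evalWord gen u = evalWord gen v) := by
  refine ((triv_comp gen hdec).comp (Computable.list_append.comp Computable.fst
    (invWord_comp.comp Computable.snd))).of_eq fun q => ?_
  rw [evalWord_append, evalWord_inv, mul_inv_eq_one]

/-- all words of given length -/
noncomputable def wordsLen (m : ℕ) (n : ℕ) : List (List (Fin m × Bool)) :=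
  Nat.rec [[]] (fun _ ws => ws.flatMap fun w =>
    (Finset.univ : Finset (Fin m × Bool)).toList.map fun l => l :: w) n

theorem mem_wordsLen (n : ℕ) (w : List (Fin m × Bool)) : w ∈ wordsLen m n ↔ w.length = n := by
  induction n generalizing w with
  | zero => simp [wordsLen]
  | succ n ih =>
    have : wordsLen m (n + 1) = (wordsLen m n).flatMap fun w =>
      (Finset.univ : Finset (Fin m × Bool)).toList.map fun l => l :: w := rfl
    rw [this, List.mem_flatMap]
    constructor
    · rintro ⟨v, hv, hw⟩
      rw [ih] at hv
      rw [List.mem_map] at hw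
      obtain ⟨l, -, rfl⟩ := hw
      simp [hv]
    · intro h
      cases w with
      | nil => simp at h
      | cons l v =>
        refine ⟨v, (ih v).2 (by simpa using h), ?_⟩
        rw [List.mem_map]
        exact ⟨l, by simp, rfl⟩

theorem wordsLen_comp : Computable (wordsLen m) := by
  have : Primrec (wordsLen m) := by
    refine Primrec.nat_rec₁ (f := fun _ ws => ws.flatMap fun w =>
      (Finset.univ : Finset (Fin m × Bool)).toList.map fun l => l :: w) [[]] ?_
    refine Primrec.list_flatMap (g := fun _ w =>
      (Finset.univ : Finset (Fin m × Bool)).toList.map fun l => l :: w) Primrec.snd ?_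
    exact Primrec.list_map (Primrec.const _)
      (Primrec.list_cons.comp Primrec.snd (Primrec.snd.comp Primrec.fst))
  exact this.to_comp

open Classical in
theorem norm_comp (hdec : ComputablePred (· ∈ WordProblem gen)) :
    Computable fun u : List (Fin m × Bool) => wordNorm gen (evalWord gen u) := by
  have key : ∀ u n, (wordsLen m n).any (fun v => decide (evalWord gen v = evalWord gen u)) = true ↔
      n ∈ { ℓ | ∃ w : List (Fin m × Bool), w.length = ℓ ∧ evalWord gen w = evalWord gen u } := by
    intro u n
    simp [mem_wordsLen]
  refine comp_search (p := fun u n =>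
    (wordsLen m n).any fun v => decide (evalWord gen v = evalWord gen u)) ?_ _ ?_ ?_
  · exact comp_any (f := fun q : List (Fin m × Bool) × ℕ => wordsLen m q.2)
      (p := fun q v => decide (evalWord gen v = evalWord gen q.1))
      (wordsLen_comp.comp Computable.snd)
      ((eq_comp gen hdec).comp Computable.snd (Computable.fst.comp Computable.fst))
  · intro u
    rw [key]
    exact Nat.sInf_mem ⟨u.length, u, rfl, rfl⟩
  · intro u k hk
    rw [Bool.eq_false_iff, Ne, key]
    exact Nat.notMem_of_lt_sInf hk

end Words

theorem tails_comp {β : Type*} [Primcodable β] : Computable (List.tails (α := β)) := by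
  have : Computable fun l : List β => l.foldr (fun b s => (fun (_ : List β)
      (q : β × List (List β)) => (q.1 :: q.2.headI) :: q.2) l (b, s)) [[]] := by
    refine comp_foldr (f := fun l : List β => l) (g := fun _ => [[]])
      (h := fun _ q => (q.1 :: q.2.headI) :: q.2) Computable.id (Computable.const [[]]) ?_
    exact Computable.list_cons.comp (Computable.list_cons.comp
      (Computable.fst.comp Computable.snd)
      (Primrec.list_headI.to_comp.comp (Computable.snd.comp Computable.snd)))
      (Computable.snd.comp Computable.snd)
  refine this.of_eq fun l => ?_
  induction l with
  | nil => rfl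
  | cons b l ih =>
    simp only [List.foldr_cons, List.tails_cons] at ih ⊢
    rw [ih]
    cases l <;> simp

/-! ### Words of `K(G,A,H)` -/

section Main
variable {mG nH : ℕ}

/-- the `G`-part of a letter -/
def gl (l : Fin (mG + 2 * nH) × Bool) : List (Fin mG × Bool) :=
  if h : (l.1 : ℕ) < mG then [(⟨l.1, h⟩, l.2)] else []

/-- the `H`-part of a letter when the symbol `b` is read -/
def hl (b : Bool) (l : Fin (mG + 2 * nH) × Bool) : List (Fin nH × Bool) :=
  if h : (l.1 : ℕ) < mG then [] else
    if b = decide (((l.1 : ℕ) - mG) % 2 = 1) then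
      [(⟨((l.1 : ℕ) - mG) / 2, by have := l.1.isLt; omega⟩, l.2)] else []

/-- the `G`-part of a word -/
def gword : List (Fin (mG + 2 * nH) × Bool) → List (Fin mG × Bool)
  | [] => []
  | l :: w => gl l ++ gword w

/-- the `H`-part of a word, when reading symbols according to `P` -/
def hw (P : List (Fin mG × Bool) → Bool) :
    List (Fin (mG + 2 * nH) × Bool) → List (Fin nH × Bool)
  | [] => []
  | l :: w => hl (P (gword w)) l ++ hw P w

theorem gword_length (w : List (Fin (mG + 2 * nH) × Bool)) : (gword w).length ≤ w.length := by
  induction w with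
  | nil => simp [gword]
  | cons l w ih =>
    have : (gl l).length ≤ 1 := by unfold gl; split_ifs <;> simp
    simp only [gword, List.length_append, List.length_cons]
    omega

theorem hw_congr (P Q : List (Fin mG × Bool) → Bool) (w : List (Fin (mG + 2 * nH) × Bool))
    (h : ∀ v, v <:+ gword w → P v = Q v) : hw P w = hw Q w := by
  induction w with
  | nil => rfl
  | cons l w ih =>
    have hs : gword w <:+ gword (l :: w) := List.suffix_append _ _
    simp only [hw]
    rw [h _ hs, ih fun v hv => h v (hv.trans hs)]

variable {G H : Type*} [Group G] [Group H] (genG : Fin mG → G) (genH : Fin nH → H)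

theorem act_letter (A : Set ℕ) (l : Fin (mG + 2 * nH) × Bool) (x : ↥(XA genG A)) (h : H) :
    ((if l.2 then genKGen genG genH A l.1 else (genKGen genG genH A l.1)⁻¹ :
        ↥(Ksub genG A H)) : Equiv.Perm (↥(XA genG A) × H)) (x, h) =
      (⟨shiftC (evalWord genG (gl l)) x.1, shiftC_mem_XA genG A _ x.2⟩,
        evalWord genH (hl (x.1 1) l) * h) := by
  have sh1 : shiftC (1 : G) x.1 = x.1 := by funext k; simp [shiftC]
  obtain ⟨i, b⟩ := l
  by_cases hi : (i : ℕ) < mG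
  · cases b
    · simp only [Bool.false_eq_true, if_false, genKGen, gl, hl, dif_pos hi]
      simp only [evalWord, List.map_cons, List.map_nil, List.prod_cons, List.prod_nil, mul_one,
        one_mul]
      rfl
    · simp only [if_true, genKGen, gl, hl, dif_pos hi]
      simp only [evalWord, List.map_cons, List.map_nil, List.prod_cons, List.prod_nil, mul_one,
        one_mul]
      rfl
  · cases b
    · simp only [Bool.false_eq_true, if_false, genKGen, gl, hl, dif_neg hi,
        evalWord_nil, sh1]
      by_cases hc : x.1 1 = decide (((i : ℕ) - mG) % 2 = 1)
      · rw [if_pos hc]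
        simp only [evalWord, List.map_cons, List.map_nil, List.prod_cons, List.prod_nil, mul_one]
        refine Prod.ext rfl ?_
        exact if_pos hc
      · rw [if_neg hc]
        refine Prod.ext rfl ?_
        refine (if_neg hc).trans ?_
        simp [evalWord]
    · simp only [if_true, genKGen, gl, hl, dif_neg hi, evalWord_nil, sh1]
      by_cases hc : x.1 1 = decide (((i : ℕ) - mG) % 2 = 1)
      · rw [if_pos hc]
        simp only [evalWord, List.map_cons, List.map_nil, List.prod_cons, List.prod_nil, mul_one]
        refine Prod.ext rfl ?_
        exact if_pos hc
      · rw [if_neg hc]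
        refine Prod.ext rfl ?_
        refine (if_neg hc).trans ?_
        simp [evalWord]

theorem act_word (A : Set ℕ) (w : List (Fin (mG + 2 * nH) × Bool)) (x : ↥(XA genG A)) (h : H) :
    ((evalWord (genKGen genG genH A) w : ↥(Ksub genG A H)) : Equiv.Perm (↥(XA genG A) × H)) (x, h) =
      (⟨shiftC (evalWord genG (gword w)) x.1, shiftC_mem_XA genG A _ x.2⟩,
        evalWord genH (hw (fun u => x.1 (evalWord genG u)⁻¹) w) * h) := by
  induction w with
  | nil =>
    have sh1 : shiftC (1 : G) x.1 = x.1 := by funext k; simp [shiftC]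
    simp [gword, hw, evalWord_nil, sh1]
  | cons l w ih =>
    rw [evalWord_cons, Subgroup.coe_mul, Equiv.Perm.mul_apply, ih, act_letter]
    simp only [gword, hw, evalWord_append]
    refine Prod.ext (Subtype.ext ?_) ?_
    · funext k
      simp [shiftC, mul_assoc]
    · simp [shiftC, mul_assoc]

open Classical in
/-- the configuration with ones at the positions given by `S` -/
noncomputable def PS (S : List (List (Fin mG × Bool))) (u : List (Fin mG × Bool)) : Bool :=
  S.any fun v => decide (evalWord genG u = evalWord genG v)

theorem PS_iff (S : List (List (Fin mG × Bool))) (u : List (Fin mG × Bool)) :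
    PS genG S u = true ↔ ∃ v ∈ S, evalWord genG u = evalWord genG v := by
  simp [PS]

theorem triv_iff (A : Set ℕ) (w : List (Fin (mG + 2 * nH) × Bool)) :
    evalWord (genKGen genG genH A) w = 1 ↔
      evalWord genG (gword w) = 1 ∧
      ∀ x ∈ XA genG A, evalWord genH (hw (fun u => x (evalWord genG u)⁻¹) w) = 1 := by
  classical
  constructor
  · intro h
    have h' : ∀ (x : ↥(XA genG A)),
        shiftC (evalWord genG (gword w)) x.1 = x.1 ∧
        evalWord genH (hw (fun u => x.1 (evalWord genG u)⁻¹) w) = 1 := by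
      intro x
      have := act_word genG genH A w x 1
      rw [h] at this
      simp only [Subgroup.coe_one, Equiv.Perm.one_apply, mul_one] at this
      rw [Prod.ext_iff] at this
      exact ⟨(congrArg Subtype.val this.1).symm, this.2.symm⟩
    refine ⟨?_, fun x hx => (h' ⟨x, hx⟩).2⟩
    have hx : (fun k : G => decide (k = 1)) ∈ XA genG A := by
      constructor
      · intro a b c ha hb hc
        simp only [decide_eq_true_eq] at ha hb
        exact Or.inl (ha.trans hb.symm)
      · intro a b ha hb hab
        simp only [decide_eq_true_eq] at ha hb
        exact absurd (ha.trans hb.symm) hab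
    have := congrFun (h' ⟨_, hx⟩).1 (evalWord genG (gword w))
    simpa [shiftC] using this
  · rintro ⟨h1, h2⟩
    apply Subtype.ext
    ext1 ⟨x, h⟩
    rw [act_word, h2 x.1 x.2, one_mul, h1]
    refine Prod.ext (Subtype.ext ?_) rfl
    funext k
    simp [shiftC]

/-- Combinatorial characterization of triviality. -/
theorem triv_iff' (A : Set ℕ) (w : List (Fin (mG + 2 * nH) × Bool)) :
    evalWord (genKGen genG genH A) w = 1 ↔
      (evalWord genG (gword w) = 1 ∧ evalWord genH (hw (PS genG []) w) = 1 ∧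
        ∀ v ∈ (gword w).tails, evalWord genH (hw (PS genG [v]) w) = 1) ∧
      ∀ v ∈ (gword w).tails, ∀ v' ∈ (gword w).tails, evalWord genG v ≠ evalWord genG v' →
        evalWord genH (hw (PS genG [v, v']) w) ≠ 1 →
        wordNorm genG (evalWord genG (v ++ invWord v')) ∈ A := by
  classical
  rw [triv_iff]
  have hPS : ∀ (S : List (List (Fin mG × Bool))),
      hw (nH := nH) (fun u => (fun k : G => decide (∃ v ∈ S, (evalWord genG v)⁻¹ = k))
        (evalWord genG u)⁻¹) w = hw (PS genG S) w := by
    intro S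
    refine hw_congr _ _ _ fun u _ => ?_
    rw [Bool.eq_iff_iff, PS_iff, decide_eq_true_iff]
    simp only [inv_inj]
    exact ⟨fun ⟨v, hv, h⟩ => ⟨v, hv, h.symm⟩, fun ⟨v, hv, h⟩ => ⟨v, hv, h.symm⟩⟩
  have hdist : ∀ v v' : List (Fin mG × Bool), wordNorm genG (evalWord genG (v ++ invWord v')) =
      wordDist genG (evalWord genG v)⁻¹ (evalWord genG v')⁻¹ := by
    intro v v'
    rw [wordDist, inv_inv, evalWord_append, evalWord_inv]
  constructor
  · rintro ⟨h1, h2⟩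
    refine ⟨⟨h1, ?_, ?_⟩, ?_⟩
    · rw [← hPS]
      refine h2 (fun k => decide (∃ y ∈ ([] : List (List (Fin mG × Bool))), (evalWord genG y)⁻¹ = k)) ?_
      constructor <;> simp
    · intro v hv
      rw [← hPS]
      refine h2 (fun k => decide (∃ y ∈ [v], (evalWord genG y)⁻¹ = k)) ?_
      constructor
      · intro a b c ha hb hc
        simp at ha hb
        exact Or.inl (ha.symm.trans hb)
      · intro a b ha hb hab
        simp at ha hb
        exact absurd (ha.symm.trans hb) hab
    · intro v hv v' hv' hne hnt
      by_contra hA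
      apply hnt
      rw [← hPS]
      refine h2 (fun k => decide (∃ y ∈ [v, v'], (evalWord genG y)⁻¹ = k)) ?_
      have hA' : wordNorm genG (evalWord genG (v' ++ invWord v)) ∉ A := by
        rw [evalWord_append, evalWord_inv, ← norm_inv, mul_inv_rev, inv_inv, ← evalWord_inv,
          ← evalWord_append]
        exact hA
      rw [hdist] at hA hA'
      constructor
      · intro a b c ha hb hc
        simp at ha hb hc
        rcases ha with ha | ha <;> rcases hb with hb | hb <;> rcases hc with hc | hc <;>
          simp [← ha, ← hb, ← hc]
      · intro a b ha hb hab
        simp at ha hb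
        rcases ha with ha | ha <;> rcases hb with hb | hb
        · exact absurd (ha.symm.trans hb) hab
        · rwa [← ha, ← hb]
        · rwa [← ha, ← hb]
        · exact absurd (ha.symm.trans hb) hab
  · rintro ⟨⟨h1, h2, h3⟩, h4⟩
    refine ⟨h1, fun x hx => ?_⟩
    by_cases c0 : ∃ v, v <:+ gword w ∧ x (evalWord genG v)⁻¹ = true
    · obtain ⟨v, hv, hxv⟩ := c0
      by_cases c1 : ∃ v', v' <:+ gword w ∧ x (evalWord genG v')⁻¹ = true ∧
          evalWord genG v ≠ evalWord genG v'
      · obtain ⟨v', hv', hxv', hne⟩ := c1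
        have : hw (nH := nH) (fun u => x (evalWord genG u)⁻¹) w = hw (PS genG [v, v']) w := by
          refine hw_congr _ _ _ fun u _ => ?_
          rw [Bool.eq_iff_iff, PS_iff]
          constructor
          · intro hu
            rcases hx.1 _ _ _ hu hxv hxv' with h | h | h
            · exact ⟨v, by simp, inv_injective h⟩
            · exact ⟨v', by simp, inv_injective h⟩
            · exact absurd (inv_injective h) hne
          · rintro ⟨y, hy, h⟩
            rw [h]
            simp at hy
            rcases hy with rfl | rfl <;> assumption
        rw [this]
        by_contra hnt
        have hA := h4 v ((List.mem_tails _ _).2 hv) v' ((List.mem_tails _ _).2 hv') hne hnt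
        rw [hdist] at hA
        exact hx.2 _ _ hxv hxv' (fun h => hne (inv_injective h)) hA
      · have : hw (nH := nH) (fun u => x (evalWord genG u)⁻¹) w = hw (PS genG [v]) w := by
          refine hw_congr _ _ _ fun u hu => ?_
          rw [Bool.eq_iff_iff, PS_iff]
          constructor
          · intro hxu
            by_contra hcon
            exact c1 ⟨u, hu, hxu, fun h => hcon ⟨v, by simp, h.symm⟩⟩
          · rintro ⟨y, hy, h⟩
            rw [h]
            simp at hy
            rw [hy]
            exact hxv
        rw [this]
        exact h3 v ((List.mem_tails _ _).2 hv)
    · have : hw (nH := nH) (fun u => x (evalWord genG u)⁻¹) w = hw (PS genG []) w := by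
        refine hw_congr _ _ _ fun u hu => ?_
        rw [Bool.eq_iff_iff, PS_iff]
        constructor
        · intro hxu
          exact absurd ⟨u, hu, hxu⟩ c0
        · simp
      rw [this]
      exact h2

theorem norm_bound (w : List (Fin (mG + 2 * nH) × Bool)) (v v' : List (Fin mG × Bool))
    (hv : v ∈ (gword w).tails) (hv' : v' ∈ (gword w).tails) :
    wordNorm genG (evalWord genG (v ++ invWord v')) ≤ w.length := by
  rw [List.mem_tails] at hv hv'
  refine le_trans ?_ (gword_length w)
  rcases List.suffix_or_suffix_of_suffix hv hv' with ⟨r, hr⟩ | ⟨r, hr⟩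
  · have : evalWord genG (v ++ invWord v') = (evalWord genG r)⁻¹ := by
      rw [evalWord_append, evalWord_inv, ← hr, evalWord_append]
      group
    rw [this, norm_inv]
    refine (norm_le _ _).trans ?_
    have := hv'.length_le
    rw [← hr, List.length_append] at this
    omega
  · have : evalWord genG (v ++ invWord v') = evalWord genG r := by
      rw [evalWord_append, evalWord_inv, ← hr, evalWord_append]
      group
    rw [this]
    refine (norm_le _ _).trans ?_
    have := hv.length_le
    rw [← hr, List.length_append] at this
    omega

theorem PS_comp (hdecG : ComputablePred (· ∈ WordProblem genG)) : Computable₂ (PS genG) :=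
  comp_any (f := fun q : List (List (Fin mG × Bool)) × List (Fin mG × Bool) => q.1)
    Computable.fst ((eq_comp genG hdecG).comp (Computable.snd.comp Computable.fst) Computable.snd)

theorem run_comp (hdecG : ComputablePred (· ∈ WordProblem genG)) :
    Computable₂ fun (S : List (List (Fin mG × Bool))) (w : List (Fin (mG + 2 * nH) × Bool)) =>
      (gword w, hw (PS genG S) w) := by
  have gl_c : Computable (gl (mG := mG) (nH := nH)) := (Primrec.dom_finite _).to_comp
  have hl_c : Computable₂ (hl (mG := mG) (nH := nH)) :=
    (Primrec.dom_finite (fun p : Bool × (Fin (mG + 2 * nH) × Bool) => hl p.1 p.2)).to_comp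
  have := comp_foldr
    (f := fun q : List (List (Fin mG × Bool)) × List (Fin (mG + 2 * nH) × Bool) => q.2)
    (g := fun _ => (([], []) : List (Fin mG × Bool) × List (Fin nH × Bool)))
    (h := fun q p => (gl p.1 ++ p.2.1, hl (PS genG q.1 p.2.1) p.1 ++ p.2.2))
    Computable.snd (Computable.const _) (by
      have c1 : Computable fun z : (List (List (Fin mG × Bool)) × List (Fin (mG + 2 * nH) × Bool)) ×
          ((Fin (mG + 2 * nH) × Bool) × (List (Fin mG × Bool) × List (Fin nH × Bool))) => z.2.1 :=
        Computable.fst.comp Computable.snd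
      have c2 : Computable fun z : (List (List (Fin mG × Bool)) × List (Fin (mG + 2 * nH) × Bool)) ×
          ((Fin (mG + 2 * nH) × Bool) × (List (Fin mG × Bool) × List (Fin nH × Bool))) => z.2.2.1 :=
        Computable.fst.comp (Computable.snd.comp Computable.snd)
      have c3 : Computable fun z : (List (List (Fin mG × Bool)) × List (Fin (mG + 2 * nH) × Bool)) ×
          ((Fin (mG + 2 * nH) × Bool) × (List (Fin mG × Bool) × List (Fin nH × Bool))) => z.2.2.2 :=
        Computable.snd.comp (Computable.snd.comp Computable.snd)
      exact Computable.pair (Computable.list_append.comp (gl_c.comp c1) c2)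
        (Computable.list_append.comp (hl_c.comp ((PS_comp genG hdecG).comp
          (Computable.fst.comp Computable.fst) c2) c1) c3))
  refine this.of_eq fun q => ?_
  obtain ⟨S, w⟩ := q
  simp only
  induction w with
  | nil => rfl
  | cons l w ih => rw [List.foldr_cons, ih]; rfl

open Classical in
/-- the static part of the decision -/
noncomputable def stat (w : List (Fin (mG + 2 * nH) × Bool)) : Bool :=
  decide (evalWord genG (gword w) = 1) && (decide (evalWord genH (hw (PS genG []) w) = 1) &&
    (gword w).tails.all fun v => decide (evalWord genH (hw (PS genG [v]) w) = 1))

open Classical in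
/-- the queries to `A` -/
noncomputable def query (w : List (Fin (mG + 2 * nH) × Bool)) (j : ℕ) : Bool :=
  (gword w).tails.any fun v => (gword w).tails.any fun v' =>
    !decide (evalWord genG v = evalWord genG v') &&
      (!decide (evalWord genH (hw (PS genG [v, v']) w) = 1) &&
        (wordNorm genG (evalWord genG (v ++ invWord v')) == j))

theorem query_iff (w : List (Fin (mG + 2 * nH) × Bool)) (j : ℕ) :
    query genG genH w j = true ↔ ∃ v ∈ (gword w).tails, ∃ v' ∈ (gword w).tails,
      evalWord genG v ≠ evalWord genG v' ∧ evalWord genH (hw (PS genG [v, v']) w) ≠ 1 ∧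
      wordNorm genG (evalWord genG (v ++ invWord v')) = j := by
  simp only [query, List.any_eq_true, Bool.and_eq_true, Bool.not_eq_true', decide_eq_false_iff_not,
    beq_iff_eq, ne_eq]

theorem stat_iff (w : List (Fin (mG + 2 * nH) × Bool)) :
    stat genG genH w = true ↔ (evalWord genG (gword w) = 1 ∧
      evalWord genH (hw (PS genG []) w) = 1 ∧
        ∀ v ∈ (gword w).tails, evalWord genH (hw (PS genG [v]) w) = 1) := by
  simp only [stat, Bool.and_eq_true, decide_eq_true_eq, List.all_eq_true]

theorem triv_iff_query (A : Set ℕ) (w : List (Fin (mG + 2 * nH) × Bool)) :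
    evalWord (genKGen genG genH A) w = 1 ↔
      stat genG genH w = true ∧ ∀ j, query genG genH w j = true → j ∈ A := by
  rw [triv_iff', stat_iff]
  refine and_congr_right fun _ => ?_
  constructor
  · intro h j hj
    rw [query_iff] at hj
    obtain ⟨v, hv, v', hv', h1, h2, rfl⟩ := hj
    exact h v hv v' hv' h1 h2
  · intro h v hv v' hv' h1 h2
    exact h _ ((query_iff _ _ _ _).2 ⟨v, hv, v', hv', h1, h2, rfl⟩)

theorem gword_comp (hdecG : ComputablePred (· ∈ WordProblem genG)) :
    Computable (gword (mG := mG) (nH := nH)) :=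
  Computable.fst.comp ((run_comp genG hdecG).comp (Computable.const []) Computable.id)

theorem hw_comp (hdecG : ComputablePred (· ∈ WordProblem genG)) :
    Computable₂ fun (S : List (List (Fin mG × Bool))) (w : List (Fin (mG + 2 * nH) × Bool)) =>
      hw (PS genG S) w :=
  Computable.snd.comp (run_comp genG hdecG)

theorem stat_comp (hdecG : ComputablePred (· ∈ WordProblem genG))
    (hdecH : ComputablePred (· ∈ WordProblem genH)) : Computable (stat genG genH) := by
  refine comp_and ((triv_comp genG hdecG).comp (gword_comp genG hdecG))
    (comp_and ((triv_comp genH hdecH).comp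
      ((hw_comp genG hdecG).comp (Computable.const []) Computable.id)) ?_)
  refine comp_all (tails_comp.comp (gword_comp genG hdecG)) ?_
  exact (triv_comp genH hdecH).comp ((hw_comp genG hdecG).comp
    (Computable.list_cons.comp Computable.snd (Computable.const [])) Computable.fst)

theorem query_comp (hdecG : ComputablePred (· ∈ WordProblem genG))
    (hdecH : ComputablePred (· ∈ WordProblem genH)) : Computable₂ (query genG genH) := by
  have ht := tails_comp.comp (gword_comp (nH := nH) genG hdecG)
  refine comp_any (f := fun q : List (Fin (mG + 2 * nH) × Bool) × ℕ => (gword q.1).tails)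
    (ht.comp Computable.fst) ?_
  refine comp_any (f := fun q : (List (Fin (mG + 2 * nH) × Bool) × ℕ) × List (Fin mG × Bool) =>
    (gword q.1.1).tails) (ht.comp (Computable.fst.comp Computable.fst)) ?_
  have cv : Computable fun z : ((List (Fin (mG + 2 * nH) × Bool) × ℕ) × List (Fin mG × Bool)) ×
      List (Fin mG × Bool) => z.1.2 := Computable.snd.comp Computable.fst
  have cv' : Computable fun z : ((List (Fin (mG + 2 * nH) × Bool) × ℕ) × List (Fin mG × Bool)) ×
      List (Fin mG × Bool) => z.2 := Computable.snd
  have cw : Computable fun z : ((List (Fin (mG + 2 * nH) × Bool) × ℕ) × List (Fin mG × Bool)) ×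
      List (Fin mG × Bool) => z.1.1.1 :=
    Computable.fst.comp (Computable.fst.comp Computable.fst)
  have cj : Computable fun z : ((List (Fin (mG + 2 * nH) × Bool) × ℕ) × List (Fin mG × Bool)) ×
      List (Fin mG × Bool) => z.1.1.2 :=
    Computable.snd.comp (Computable.fst.comp Computable.fst)
  refine comp_and (comp_not ((eq_comp genG hdecG).comp cv cv')) (comp_and (comp_not ?_) ?_)
  · exact (triv_comp genH hdecH).comp ((hw_comp genG hdecG).comp
      (Computable.list_cons.comp cv (Computable.list_cons.comp cv' (Computable.const []))) cw)
  · exact Primrec.beq.to_comp.comp ((norm_comp genG hdecG).comp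
      (Computable.list_append.comp cv (invWord_comp.comp cv'))) cj

theorem main (hdecG : ComputablePred (· ∈ WordProblem genG))
    (hdecH : ComputablePred (· ∈ WordProblem genH)) (A : Set ℕ) :
    ∃ β : ℕ → ℕ, ConjRedRate (WordProblem (genKGen genG genH A)) A β ∧
      ∃ c : ℝ, 1 < c ∧ ∃ N : ℕ, ∀ n ≥ N, c ^ n ≤ (β n : ℝ) := by
  rcases Nat.eq_zero_or_pos (mG + 2 * nH) with h0 | hpos
  · refine conj_of_queries A _ (fun i => i == 0) (fun _ _ => false)
      (Primrec.beq.to_comp.comp Computable.id (Computable.const 0)) (Computable.const false) ?_ ?_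
    · intro i
      simp only [beq_iff_eq, Bool.false_eq_true, false_imp_iff, implies_true, and_true]
      constructor
      · rintro ⟨w, hw, -⟩
        cases w with
        | nil => exact hw.symm
        | cons l w => have := l.1.isLt; omega
      · rintro rfl
        exact ⟨[], rfl, rfl⟩
    · simp
  · choose dec hdec using wordCode_surjective hpos
    have cdec : Computable dec := comp_inverse _ wordCode_comp wordCode_injective dec hdec
    refine conj_of_queries A _ (fun i => stat genG genH (dec i))
      (fun i j => query genG genH (dec i) j) ((stat_comp genG genH hdecG hdecH).comp cdec)
      ((query_comp genG genH hdecG hdecH).comp (cdec.comp Computable.fst) Computable.snd) ?_ ?_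
    · intro i
      rw [← triv_iff_query]
      constructor
      · rintro ⟨w, hw, h⟩
        rwa [wordCode_injective ((hdec i).trans hw.symm)]
      · intro h
        exact ⟨dec i, hdec i, h⟩
    · intro i j _ hj
      rw [query_iff] at hj
      obtain ⟨v, hv, v', hv', -, -, rfl⟩ := hj
      have h1 := wordCode_length (dec i)
      rw [hdec] at h1
      exact (Nat.pow_le_pow_right (by norm_num) (norm_bound genG _ v v' hv hv')).trans h1

end Main

end KConj

/-- If `G` and `H` have decidable word problems then the word problem
of `K(G,A,H)` conjunctively reduces to `A` with a rate `β` that grows exponentially. -/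
theorem Ksub_conj_reduces {G H : Type*} [Group G] [Group H] {mG nH : ℕ}
    (genG : Fin mG → G) (genH : Fin nH → H)
    (hG : Subgroup.closure (Set.range genG) = ⊤)
    (hH : Subgroup.closure (Set.range genH) = ⊤)
    (hdecG : ComputablePred (· ∈ WordProblem genG))
    (hdecH : ComputablePred (· ∈ WordProblem genH))
    (A : Set ℕ) :
    ∃ β : ℕ → ℕ, ConjRedRate (WordProblem (genKGen genG genH A)) A β ∧
      ∃ c : ℝ, 1 < c ∧ ∃ N : ℕ, ∀ n ≥ N, c ^ n ≤ (β n : ℝ) := by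
  exact KConj.main genG genH hdecG hdecH A
end
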